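/- (Exponential decay of the discrete inverse) Let n ≥ 2. There exist constants d₀ ∈ (0,1) and C₇ ∈ (0,1) depending only on a, n, D and T such that the following holds whenever h = dσ with 0 < d ≤ d₀ and t ∈ [0,T]. Fix a grid cell Q_j^σ, let f ∈ L²(Ω), and suppose f_{j,σ} ∈ V_σ^n(Ω) satisfies Σ_{i=1}^N w_i f_{j,σ}(x_i(t)) v(x_i(t)) = ∫_{Q_j^σ} f v dx for all v ∈ V_σ^n(Ω). For k ∈ ℕ let D_{j,k} denote the union of all cells Q_l^σ whose centres satisfy |centre(Q_l^σ) − centre(Q_j^σ)|_∞ < kσ in the maximum norm. Then for every k ∈ ℕ: ‖f_{j,σ}‖²_{L²(Ω∖D_{j,k})} ≤ C₇^{⌊k/n⌋} ‖f_{j,σ}‖²_{L²(Ω)}. -/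

import Mathlib

open MeasureTheory
open scoped ENNReal NNReal

noncomputable section

/-- The open unit cube `Ω = (0,1)^D`. -/
def unitCube (D : ℕ) : Set (Fin D → ℝ) := {x | ∀ i, x i ∈ Set.Ioo (0 : ℝ) 1}

/-- The grid cell with multi-index `k` in the uniform partition of the unit cube into
`M^D` cubes of edge length `1/M`. -/
def cell (D M : ℕ) (k : Fin D → Fin M) : Set (Fin D → ℝ) :=
  {x | ∀ i, ((k i : ℕ) : ℝ) / M ≤ x i ∧ x i < (((k i : ℕ) : ℝ) + 1) / M}

/-- Membership in the tensor-product spline space `V_σ^n(Ω)`, `σ = 1/M`: the function is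
`C^{n-2}` on `Ω` and coincides on every grid cell with a polynomial of coordinate-wise
degree at most `n-1`. -/
def IsSpline (D M n : ℕ) (u : (Fin D → ℝ) → ℝ) : Prop :=
  ContDiffOn ℝ (n - 2 : ℕ) u (unitCube D) ∧
  ∀ k : Fin D → Fin M, ∃ p : MvPolynomial (Fin D) ℝ,
    (∀ i, p.degreeOf i ≤ n - 1) ∧ ∀ x ∈ cell D M k, u x = MvPolynomial.eval x p

/-- A smooth, bounded, divergence-free velocity field `a` on `Ω × [0,T]`, tangent to the
boundary of the unit cube, together with its flow maps: `X τ t = X_{τ→t}`, so that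
`X τ t x` is the position at time `t` of the trajectory passing through `x` at time `τ`. -/
structure FlowData (D : ℕ) (T : ℝ) where
  a : (Fin D → ℝ) → ℝ → (Fin D → ℝ)
  X : ℝ → ℝ → (Fin D → ℝ) → (Fin D → ℝ)
  smooth : ContDiff ℝ (⊤ : ℕ∞) (Function.uncurry a)
  bounded : ∃ B, ∀ x t, ‖a x t‖ ≤ B
  div_free : ∀ x t, ∑ i, fderiv ℝ (fun y => a y t i) x (Pi.single i 1) = 0
  tangent : ∀ t ∈ Set.Icc (0 : ℝ) T, ∀ x ∈ closure (unitCube D), ∀ i,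
      (x i = 0 ∨ x i = 1) → a x t i = 0
  flow_init : ∀ τ x, X τ τ x = x
  flow_ode : ∀ τ x t, HasDerivAt (fun s => X τ s x) (a (X τ t x) t) t
  flow_inv : ∀ τ t x, X t τ (X τ t x) = x

/-- The discrete neighbourhood `D_{j,k}`: the union of all cells `Q_l^σ` of the `σ`-grid
(`σ = 1/M`) whose centres satisfy `|centre(Q_l^σ) − centre(Q_j^σ)|_∞ < kσ` in the maximum
norm.  In particular `D_{j,0} = ∅` and `D_{j,1} = Q_j^σ`. -/
def cellNbhd (D M : ℕ) (j : Fin D → Fin M) (k : ℕ) : Set (Fin D → ℝ) :=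
  ⋃ (l : Fin D → Fin M)
    (_ : ∀ i, |(((l i : ℕ) : ℝ) + 1 / 2) / M - (((j i : ℕ) : ℝ) + 1 / 2) / M| <
      (k : ℝ) / M), cell D M l

section TruncatedPower

/-- The derivative of a truncated power of exponent at least two. -/
theorem hasDerivAt_max_zero_pow (m : ℕ) (x : ℝ) :
    HasDerivAt (fun y : ℝ => (max y 0) ^ (m + 2)) (((m : ℝ) + 2) * (max x 0) ^ (m + 1)) x := by
  rcases lt_trichotomy x 0 with hx | rfl | hx
  · rw [max_eq_right hx.le]
    have : (fun y : ℝ => (max y 0) ^ (m + 2)) =ᶠ[nhds x] fun _ => 0 := by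
      filter_upwards [Iio_mem_nhds hx] with y hy
      simp [max_eq_right (Set.mem_Iio.1 hy).le]
    simpa using (hasDerivAt_const x (0 : ℝ)).congr_of_eventuallyEq this
  · have h : (fun y : ℝ => (max y 0) ^ (m + 2)) =O[nhds 0] fun y : ℝ => ‖y - 0‖ ^ (m + 2) := by
      refine Asymptotics.IsBigO.of_bound 1 (Filter.Eventually.of_forall fun y => ?_)
      rw [norm_pow, norm_pow, one_mul, sub_zero, norm_norm]
      gcongr
      rw [Real.norm_eq_abs, Real.norm_eq_abs, abs_of_nonneg (le_max_right _ _)]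
      exact max_le (le_abs_self _) (abs_nonneg _)
    simpa using (h.hasFDerivAt (by omega)).hasDerivAt
  · rw [max_eq_left hx.le]
    have : (fun y : ℝ => (max y 0) ^ (m + 2)) =ᶠ[nhds x] fun y => y ^ (m + 2) := by
      filter_upwards [Ioi_mem_nhds hx] with y hy
      simp [max_eq_left (Set.mem_Ioi.1 hy).le]
    simpa using (hasDerivAt_pow (m + 2) x).congr_of_eventuallyEq this

/-- The truncated power of exponent `m + 1` is `m` times continuously differentiable. -/
theorem contDiff_max_zero_pow (m : ℕ) :
    ContDiff ℝ m (fun y : ℝ => (max y 0) ^ (m + 1)) := by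
  induction m with
  | zero => simpa [contDiff_zero] using continuous_id.max continuous_const
  | succ m ih =>
    push_cast
    rw [contDiff_succ_iff_deriv]
    refine ⟨fun x => (hasDerivAt_max_zero_pow m x).differentiableAt, by simp, ?_⟩
    rw [show deriv (fun y : ℝ => (max y 0) ^ (m + 1 + 1)) =
      fun x => ((m : ℝ) + 2) * (max x 0) ^ (m + 1) from
        funext fun x => (hasDerivAt_max_zero_pow m x).deriv]
    exact contDiff_const.mul ih

end TruncatedPower

section CardinalBSpline

open Polynomial

/-- The cardinal B-spline of degree `m` with knots `0, 1, …, m + 1` (unnormalized). -/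
def cardinalBSpline (m : ℕ) (x : ℝ) : ℝ :=
  ∑ k ∈ Finset.range (m + 2), (-1 : ℝ) ^ k * (m + 1).choose k * (max (x - k) 0) ^ m

/-- The polynomial `y ↦ cardinalBSpline m (y + r)` on `[0, 1)`. -/
def bsplinePiece (m r : ℕ) : ℝ[X] :=
  ∑ k ∈ Finset.range (r + 1), C ((-1 : ℝ) ^ k * (m + 1).choose k) * (X + C ((r : ℝ) - k)) ^ m

/-- The restriction to a fixed cell of the `s`-th B-spline (from the left) active there. -/
def cellBasis (m : ℕ) (s : Fin (m + 1)) : ℝ[X] := bsplinePiece m (m - s)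

theorem contDiff_cardinalBSpline (m : ℕ) : ContDiff ℝ m (cardinalBSpline (m + 1)) := by
  unfold cardinalBSpline
  refine ContDiff.sum fun k _ => contDiff_const.mul ?_
  exact (contDiff_max_zero_pow m).comp (contDiff_id.sub contDiff_const)

theorem bsplinePiece_eq_zero {m r : ℕ} (h : m < r) : bsplinePiece m r = 0 := by
  refine Polynomial.funext fun y => ?_
  have hsub : bsplinePiece m r = ∑ k ∈ Finset.range (m + 1 + 1),
      C ((-1 : ℝ) ^ k * (m + 1).choose k) * (X + C ((r : ℝ) - k)) ^ m := by
    refine (Finset.sum_subset (Finset.range_mono (by omega)) fun k _ hk => ?_).symm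
    rw [Nat.choose_eq_zero_of_lt (by simpa using hk)]
    simp
  have hd : (((C (y + r) - X) ^ m : ℝ[X])).natDegree < m + 1 := by
    refine Nat.lt_succ_of_le ((natDegree_pow_le).trans ?_)
    have : (C (y + r) - X : ℝ[X]).natDegree ≤ 1 := by
      refine (natDegree_sub_le _ _).trans ?_
      simp
    nlinarith
  have h0 := congrFun (Polynomial.fwdDiff_iter_eq_zero_of_degree_lt hd) 0
  rw [fwdDiff_iter_eq_sum_shift] at h0
  rw [hsub, eval_finsetSum, eval_zero]
  have h1 : (-1 : ℝ) ^ (m + 1) * ∑ k ∈ Finset.range (m + 1 + 1),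
      ((-1 : ℤ) ^ (m + 1 - k) * (m + 1).choose k) •
        eval (0 + k • (1 : ℝ)) ((C (y + r) - X) ^ m : ℝ[X]) = 0 := by
    rw [h0]; simp
  rw [← h1, Finset.mul_sum]
  refine Finset.sum_congr rfl fun k hk => ?_
  have hk' : k ≤ m + 1 := by simpa [Nat.lt_succ_iff] using hk
  have hs : (-1 : ℝ) ^ (m + 1) * (-1) ^ (m + 1 - k) = (-1) ^ k := by
    rw [← pow_add, show m + 1 + (m + 1 - k) = k + 2 * (m + 1 - k) by omega, pow_add, pow_mul]
    simp
  simp only [eval_mul, eval_C, eval_pow, eval_add, eval_X, eval_sub, zsmul_eq_mul, nsmul_eq_mul,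
    zero_add, mul_one]
  push_cast
  rw [← hs]
  ring

theorem cardinalBSpline_cell (m l a : ℕ) (hm : m ≠ 0) {y : ℝ} (hy : y ∈ Set.Ico (0 : ℝ) 1) :
    cardinalBSpline m (y + l - a + m) =
      if h : l ≤ a ∧ a < l + (m + 1) then (cellBasis m ⟨a - l, by omega⟩).eval y else 0 := by
  have hneg : ∀ k : ℕ, l + m < a + k → (max (y + l - a + m - k) 0) ^ m = 0 := by
    intro k hk
    have : ((l : ℝ) + m + 1) ≤ a + k := by exact_mod_cast hk
    rw [max_eq_right (by linarith [hy.2]), zero_pow hm]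
  by_cases ha : a ≤ l + m
  · obtain ⟨r, hr⟩ := Nat.exists_eq_add_of_le ha
    have hpiece : cardinalBSpline m (y + l - a + m) = (bsplinePiece m r).eval y := by
      have hr' : (l : ℝ) + m = a + r := by exact_mod_cast hr
      rw [bsplinePiece, eval_finsetSum, cardinalBSpline]
      have h1 : ∑ k ∈ Finset.range (m + 2), (-1 : ℝ) ^ k * (m + 1).choose k *
            (max (y + l - a + m - k) 0) ^ m =
          ∑ k ∈ Finset.range (m + 2 + (r + 1)), (-1 : ℝ) ^ k * (m + 1).choose k *
            (max (y + l - a + m - k) 0) ^ m := by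
        refine Finset.sum_subset (Finset.range_mono (by omega)) fun k _ hk => ?_
        rw [Nat.choose_eq_zero_of_lt (by simp at hk; omega)]
        simp
      have h2 : ∑ k ∈ Finset.range (r + 1), (-1 : ℝ) ^ k * (m + 1).choose k *
            (max (y + l - a + m - k) 0) ^ m =
          ∑ k ∈ Finset.range (m + 2 + (r + 1)), (-1 : ℝ) ^ k * (m + 1).choose k *
            (max (y + l - a + m - k) 0) ^ m := by
        refine Finset.sum_subset (Finset.range_mono (by omega)) fun k _ hk => ?_
        rw [hneg k (by simp at hk; omega)]
        simp
      rw [h1, ← h2]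
      refine Finset.sum_congr rfl fun k hk => ?_
      have hk' : (k : ℝ) ≤ r := by
        exact_mod_cast (by simpa [Nat.lt_succ_iff] using hk : k ≤ r)
      rw [max_eq_left (by linarith [hy.1])]
      simp only [eval_mul, eval_C, eval_pow, eval_add, eval_X]
      congr 2
      linarith
    rw [hpiece]
    split_ifs with h
    · rw [cellBasis, show m - (a - l) = r by omega]
    · rw [bsplinePiece_eq_zero (by omega), eval_zero]
  · rw [dif_neg (by omega), cardinalBSpline]
    refine Finset.sum_eq_zero fun k _ => ?_
    rw [hneg k (by omega), mul_zero]

theorem bsplinePiece_comp_add_one (m r : ℕ) :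
    (bsplinePiece m r).comp (X + 1) =
      bsplinePiece m (r + 1) - C ((-1 : ℝ) ^ (r + 1) * (m + 1).choose (r + 1)) * X ^ m := by
  rw [bsplinePiece, bsplinePiece, Finset.sum_range_succ _ (r + 1)]
  simp only [sub_self, map_zero, add_zero, add_sub_cancel_right]
  rw [Polynomial.sum_comp]
  refine Finset.sum_congr rfl fun k _ => ?_
  simp only [mul_comp, C_comp, pow_comp, add_comp, X_comp]
  congr 2
  push_cast
  simp only [C_sub, C_add, C_1]
  ring

theorem cellBasis_mem (m : ℕ) (s : Fin (m + 1)) : cellBasis m s ∈ degreeLT ℝ (m + 1) := by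
  unfold cellBasis bsplinePiece
  refine Submodule.sum_mem _ fun k _ => ?_
  rw [← smul_eq_C_mul]
  refine Submodule.smul_mem _ _ ?_
  rw [mem_degreeLT]
  refine degree_le_natDegree.trans_lt ?_
  rw [natDegree_pow, natDegree_X_add_C, mul_one]
  exact_mod_cast Nat.lt_succ_self m

theorem shifted_pow_mem_span (m : ℕ) (r : ℕ) (hr : r ≤ m) :
    ((X + C (r : ℝ)) ^ m : ℝ[X]) ∈ Submodule.span ℝ (Set.range (cellBasis m)) := by
  induction r using Nat.strong_induction_on with
  | _ r ih =>
    have h : ((X + C (r : ℝ)) ^ m : ℝ[X]) = cellBasis m ⟨m - r, by omega⟩ -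
        ∑ k ∈ Finset.range r, ((-1 : ℝ) ^ (k + 1) * (m + 1).choose (k + 1)) •
          (X + C (((r - (k + 1) : ℕ)) : ℝ)) ^ m := by
      rw [cellBasis]
      simp only [show m - (m - r) = r by omega]
      rw [bsplinePiece, Finset.sum_range_succ', eq_sub_iff_add_eq, add_comm]
      congr 1
      · refine Finset.sum_congr rfl fun k hk => ?_
        rw [smul_eq_C_mul, Nat.cast_sub (by simpa using hk)]
      · simp
    rw [h]
    refine sub_mem (Submodule.subset_span ⟨_, rfl⟩) (Submodule.sum_mem _ fun k hk => ?_)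
    have := Finset.mem_range.1 hk
    exact Submodule.smul_mem _ _ (ih _ (by omega) (by omega))

theorem linearIndependent_shifted_pow (m : ℕ) :
    LinearIndependent ℝ (fun r : Fin (m + 1) => ((X + C ((r : ℕ) : ℝ)) ^ m : ℝ[X])) := by
  rw [Fintype.linearIndependent_iff]
  intro g hg
  refine congrFun (Matrix.eq_zero_of_forall_pow_sum_mul_pow_eq_zero
    (f := fun r : Fin (m + 1) => ((r : ℕ) : ℝ)) ?_ fun i => ?_)
  · intro a b h
    exact Fin.ext (Nat.cast_injective (R := ℝ) h)
  · have h := congrArg (fun p => coeff p (m - i)) hg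
    simp only [finsetSum_coeff, coeff_smul, coeff_X_add_C_pow, coeff_zero, smul_eq_mul] at h
    rw [show m - (m - (i : ℕ)) = i by omega] at h
    simp only [← mul_assoc] at h
    rw [← Finset.sum_mul] at h
    refine (mul_eq_zero.1 h).resolve_right ?_
    exact_mod_cast (Nat.choose_pos (by omega)).ne'

theorem le_finrank_span_cellBasis (m : ℕ) :
    m + 1 ≤ Module.finrank ℝ (Submodule.span ℝ (Set.range (cellBasis m))) := by
  have h := finrank_span_eq_card (linearIndependent_shifted_pow m)
  rw [Fintype.card_fin] at h
  refine h.symm.le.trans ?_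
  have : FiniteDimensional ℝ (Submodule.span ℝ (Set.range (cellBasis m))) :=
    FiniteDimensional.span_of_finite ℝ (Set.finite_range _)
  refine Submodule.finrank_mono (Submodule.span_le.2 ?_)
  rintro _ ⟨r, rfl⟩
  exact shifted_pow_mem_span m r (by omega)

theorem linearIndependent_cellBasis (m : ℕ) : LinearIndependent ℝ (cellBasis m) := by
  rw [linearIndependent_iff_card_le_finrank_span, Fintype.card_fin]
  exact le_finrank_span_cellBasis m

theorem span_cellBasis (m : ℕ) :
    Submodule.span ℝ (Set.range (cellBasis m)) = degreeLT ℝ (m + 1) := by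
  have : FiniteDimensional ℝ (degreeLT ℝ (m + 1)) :=
    (degreeLTEquiv ℝ (m + 1)).symm.finiteDimensional
  refine Submodule.eq_of_le_of_finrank_le (Submodule.span_le.2 ?_) ?_
  · rintro _ ⟨s, rfl⟩
    exact cellBasis_mem m s
  · rw [(degreeLTEquiv ℝ (m + 1)).finrank_eq, Module.finrank_fin_fun]
    exact le_finrank_span_cellBasis m

theorem exists_cellBasis_coeff {m : ℕ} {P : ℝ[X]} (hP : P.natDegree ≤ m) :
    ∃ γ : Fin (m + 1) → ℝ, P = ∑ s, γ s • cellBasis m s := by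
  have h : P ∈ Submodule.span ℝ (Set.range (cellBasis m)) := by
    rw [span_cellBasis, mem_degreeLT]
    refine degree_le_natDegree.trans_lt ?_
    exact_mod_cast Nat.lt_succ_of_le hP
  obtain ⟨γ, hγ⟩ := (Submodule.mem_span_range_iff_exists_fun ℝ).1 h
  exact ⟨γ, hγ.symm⟩

/-- If two polynomials on adjacent cells differ by a multiple of the truncated power at the common
knot, the coefficients of the B-splines active on both cells agree. -/
theorem cellBasis_coeff_shift {m : ℕ} {γ γ' : Fin (m + 1) → ℝ} {κ : ℝ}
    (h : ∑ s, γ' s • cellBasis m s - (∑ s, γ s • cellBasis m s).comp (X + 1) = C κ * X ^ m)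
    (s : Fin m) : γ' s.castSucc = γ s.succ := by
  have hlast : cellBasis m (Fin.last m) = X ^ m := by simp [cellBasis, bsplinePiece]
  have hshift : ∀ s : Fin m, ∃ e : ℝ, (cellBasis m s.succ).comp (X + 1) =
      cellBasis m s.castSucc - e • cellBasis m (Fin.last m) := by
    intro s
    refine ⟨(-1 : ℝ) ^ (m - (s + 1 : ℕ) + 1) * (m + 1).choose (m - (s + 1 : ℕ) + 1), ?_⟩
    rw [hlast, smul_eq_C_mul, cellBasis, cellBasis, bsplinePiece_comp_add_one]
    simp only [Fin.val_succ, Fin.val_castSucc]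
    rw [show m - (s + 1 : ℕ) + 1 = m - s by omega]
  have hzero : ∃ e : ℝ, (cellBasis m 0).comp (X + 1) = - (e • cellBasis m (Fin.last m)) := by
    refine ⟨(-1 : ℝ) ^ (m + 1) * (m + 1).choose (m + 1), ?_⟩
    rw [hlast, smul_eq_C_mul, cellBasis, Fin.val_zero, Nat.sub_zero, bsplinePiece_comp_add_one,
      bsplinePiece_eq_zero (by simp), zero_sub]
  choose e he using hshift
  obtain ⟨e₀, he₀⟩ := hzero
  rw [← hlast, ← smul_eq_C_mul, Fin.sum_univ_castSucc, Fin.sum_univ_succ (fun s => γ s • _)]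
    at h
  simp only [add_comp, Polynomial.sum_comp, smul_comp, he, he₀] at h
  have hli := Fintype.linearIndependent_iff.1 (linearIndependent_cellBasis m)
    (Fin.lastCases (γ' (Fin.last m) + γ 0 * e₀ + ∑ s : Fin m, γ s.succ * e s - κ)
      fun s => γ' s.castSucc - γ s.succ) ?_ s.castSucc
  · simpa [sub_eq_zero] using hli
  · rw [Fin.sum_univ_castSucc]
    simp only [Fin.lastCases_castSucc, Fin.lastCases_last]
    rw [← sub_eq_zero] at h
    rw [← h]
    simp only [smul_sub, Finset.sum_sub_distrib, sub_smul, add_smul, Finset.sum_smul, smul_smul,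
      smul_neg]
    abel

/-- Interior interpolation nodes of the unit interval. -/
def interpNode (m : ℕ) (i : Fin (m + 1)) : ℝ := ((i : ℕ) + 1) / (m + 2)

theorem interpNode_mem (m : ℕ) (i : Fin (m + 1)) : interpNode m i ∈ Set.Ioo (0 : ℝ) 1 := by
  unfold interpNode
  refine ⟨by positivity, ?_⟩
  rw [div_lt_one (by positivity)]
  have : ((i : ℕ) : ℝ) < m + 1 := by exact_mod_cast i.2
  linarith

theorem interpNode_injective (m : ℕ) : Function.Injective (interpNode m) := by
  intro i j h
  unfold interpNode at h
  rw [div_left_inj' (by positivity), add_left_inj] at h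
  exact Fin.ext (Nat.cast_injective (R := ℝ) h)

/-- Interpolation at the nodes yields functionals dual to the cell basis. -/
theorem exists_dual_cellBasis (m : ℕ) : ∃ A : Fin (m + 1) → Fin (m + 1) → ℝ,
    ∀ s s', ∑ i, A s i * (cellBasis m s').eval (interpNode m i) = if s = s' then 1 else 0 := by
  let B : Matrix (Fin (m + 1)) (Fin (m + 1)) ℝ :=
    Matrix.of fun i s => (cellBasis m s).eval (interpNode m i)
  have hB : Function.Injective B.mulVec := by
    rw [← Matrix.coe_mulVecLin, ← LinearMap.ker_eq_bot, LinearMap.ker_eq_bot']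
    intro γ hγ
    have hz : ∑ s, γ s • cellBasis m s = 0 := by
      refine eq_zero_of_degree_lt_of_eval_index_eq_zero (s := Finset.univ) (v := interpNode m)
        (interpNode_injective m).injOn ?_ fun i _ => ?_
      · rw [Finset.card_univ, Fintype.card_fin, ← mem_degreeLT]
        exact Submodule.sum_mem _ fun s _ => Submodule.smul_mem _ _ (cellBasis_mem m s)
      · have := congrFun hγ i
        simp only [Matrix.mulVecLin_apply, Matrix.mulVec, dotProduct, B, Matrix.of_apply,
          Pi.zero_apply] at this
        rw [eval_finsetSum, ← this]
        refine Finset.sum_congr rfl fun s _ => ?_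
        rw [eval_smul, smul_eq_mul, mul_comm]
    exact funext (Fintype.linearIndependent_iff.1 (linearIndependent_cellBasis m) γ hz)
  have hU : IsUnit B := Matrix.mulVec_injective_iff_isUnit.1 hB
  refine ⟨fun s i => B⁻¹ s i, fun s s' => ?_⟩
  have := congrFun (congrFun (Matrix.nonsing_inv_mul B ((Matrix.isUnit_iff_isUnit_det B).1 hU)) s) s'
  simpa [Matrix.mul_apply, Matrix.one_apply, B] using this

end CardinalBSpline

section TensorCell

open Polynomial

/-- The tensor-product polynomial with coefficients `c` in the B-spline basis of a cell, as a
function of the local coordinates of the cell. -/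
def tensorEval {D m : ℕ} (c : (Fin D → Fin (m + 1)) → ℝ) (y : Fin D → ℝ) : ℝ :=
  ∑ s, c s * ∏ i, (cellBasis m (s i)).eval (y i)

theorem continuous_tensorEval {D m : ℕ} (c : (Fin D → Fin (m + 1)) → ℝ) :
    Continuous (tensorEval c) := by
  unfold tensorEval
  fun_prop

/-- The tensor coefficients are recovered from the values at the tensor grid of nodes. -/
theorem exists_dual_tensorEval (D m : ℕ) :
    ∃ A : (Fin D → Fin (m + 1)) → (Fin D → Fin (m + 1)) → ℝ,
      ∀ (c : (Fin D → Fin (m + 1)) → ℝ) s,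
        c s = ∑ σ, A s σ * tensorEval c (fun i => interpNode m (σ i)) := by
  obtain ⟨A, hA⟩ := exists_dual_cellBasis m
  refine ⟨fun s σ => ∏ i, A (s i) (σ i), fun c s => ?_⟩
  unfold tensorEval
  simp only [Finset.mul_sum]
  rw [Finset.sum_comm]
  have key : ∀ s', ∑ σ : Fin D → Fin (m + 1), (∏ i, A (s i) (σ i)) *
      (c s' * ∏ i, (cellBasis m (s' i)).eval (interpNode m (σ i))) =
      if s = s' then c s' else 0 := by
    intro s'
    have h := Finset.prod_univ_sum (fun _ : Fin D => (Finset.univ : Finset (Fin (m + 1))))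
      (fun i j => A (s i) j * (cellBasis m (s' i)).eval (interpNode m j))
    simp only [hA, Fintype.piFinset_univ, Finset.prod_mul_distrib] at h
    calc _ = c s' * ∑ σ : Fin D → Fin (m + 1), (∏ i, A (s i) (σ i)) *
          ∏ i, (cellBasis m (s' i)).eval (interpNode m (σ i)) := by
            rw [Finset.mul_sum]
            exact Finset.sum_congr rfl fun σ _ => by ring
      _ = _ := by
            rw [← h]
            split_ifs with hs
            · simp [hs]
            · obtain ⟨i, hi⟩ := Function.ne_iff.1 hs
              rw [Finset.prod_eq_zero (Finset.mem_univ i) (if_neg hi), mul_zero]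
  simp [key]

theorem tensorEval_sub {D m : ℕ} (c : (Fin D → Fin (m + 1)) → ℝ) (y z : Fin D → ℝ) :
    tensorEval c y - tensorEval c z =
      ∑ s, c s * (∏ i, (cellBasis m (s i)).eval (y i) - ∏ i, (cellBasis m (s i)).eval (z i)) := by
  simp [tensorEval, mul_sub, Finset.sum_sub_distrib]

/-- Uniform upper bound on the unit cell. -/
theorem exists_tensorEval_le (D m : ℕ) : ∃ B : ℝ, 0 < B ∧
    ∀ (c : (Fin D → Fin (m + 1)) → ℝ) (y : Fin D → ℝ), y ∈ Set.Icc 0 1 →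
      |tensorEval c y| ≤ B * ‖c‖ := by
  have h : ∀ s : Fin D → Fin (m + 1), ∃ b : ℝ, ∀ y ∈ Set.Icc (0 : Fin D → ℝ) 1,
      ‖∏ i, (cellBasis m (s i)).eval (y i)‖ ≤ b := fun s =>
    (isCompact_Icc).exists_bound_of_continuousOn (by fun_prop)
  choose b hb using h
  refine ⟨1 + ∑ s, |b s|, by positivity, fun c y hy => ?_⟩
  calc |tensorEval c y| ≤ ∑ s, |c s * ∏ i, (cellBasis m (s i)).eval (y i)| :=
        Finset.abs_sum_le_sum_abs _ _
    _ ≤ ∑ s, ‖c‖ * |b s| := by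
        refine Finset.sum_le_sum fun s _ => ?_
        rw [abs_mul]
        exact mul_le_mul (norm_le_pi_norm c s) ((hb s y hy).trans (le_abs_self _))
          (abs_nonneg _) (norm_nonneg _)
    _ ≤ (1 + ∑ s, |b s|) * ‖c‖ := by
        rw [← Finset.mul_sum]
        nlinarith [norm_nonneg c]

/-- Every tensor-product polynomial is comparable to its coefficients on some ball of fixed radius
inside the unit cell. -/
theorem exists_le_tensorEval (D m : ℕ) : ∃ r η : ℝ, 0 < r ∧ r < 1 ∧ 0 < η ∧
    ∀ c : (Fin D → Fin (m + 1)) → ℝ, ∃ z : Fin D → ℝ,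
      Metric.ball z r ⊆ unitCube D ∧ z ∈ unitCube D ∧
        ∀ y ∈ Metric.ball z r, η * ‖c‖ ≤ |tensorEval c y| := by
  obtain ⟨A, hA⟩ := exists_dual_tensorEval D m
  set S : ℝ := 1 + ∑ s, ∑ σ, |A s σ| with hS
  have hS0 : 0 < S := by positivity
  set N : ℝ := (Fintype.card (Fin D → Fin (m + 1)) : ℝ) with hN
  have hN0 : 0 < N := by
    rw [hN]; exact_mod_cast Fintype.card_pos
  have hopen : IsOpen (unitCube D) := by
    have : unitCube D = Set.univ.pi fun _ => Set.Ioo (0 : ℝ) 1 := by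
      ext x; simp [unitCube]
    rw [this]
    exact isOpen_set_pi Set.finite_univ fun _ _ => isOpen_Ioo
  have hnear : ∀ σ : Fin D → Fin (m + 1), ∀ᶠ r in nhdsWithin (0 : ℝ) (Set.Ioi 0),
      Metric.ball (fun i => interpNode m (σ i)) r ⊆ {y | y ∈ unitCube D ∧
        ∀ s : Fin D → Fin (m + 1), |∏ i, (cellBasis m (s i)).eval (y i) -
          ∏ i, (cellBasis m (s i)).eval (interpNode m (σ i))| < 1 / (2 * S * N)} := by
    intro σ
    have hmem : {y | y ∈ unitCube D ∧
        ∀ s : Fin D → Fin (m + 1), |∏ i, (cellBasis m (s i)).eval (y i) -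
          ∏ i, (cellBasis m (s i)).eval (interpNode m (σ i))| < 1 / (2 * S * N)} ∈
          nhds (fun i => interpNode m (σ i)) := by
      have h1 : ∀ᶠ y in nhds (fun i => interpNode m (σ i)), y ∈ unitCube D :=
        hopen.mem_nhds fun i => interpNode_mem m (σ i)
      have h2 : ∀ᶠ y : Fin D → ℝ in nhds (fun i => interpNode m (σ i)),
          ∀ s : Fin D → Fin (m + 1), |∏ i, (cellBasis m (s i)).eval (y i) -
          ∏ i, (cellBasis m (s i)).eval (interpNode m (σ i))| < 1 / (2 * S * N) := by
        rw [Filter.eventually_all]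
        intro s
        have hc : Continuous fun y : Fin D → ℝ => |∏ i, (cellBasis m (s i)).eval (y i) -
            ∏ i, (cellBasis m (s i)).eval (interpNode m (σ i))| := by fun_prop
        refine hc.continuousAt.eventually_lt continuousAt_const ?_
        simp only [sub_self, abs_zero]
        positivity
      exact h1.and h2
    obtain ⟨ε, hε, hball⟩ := Metric.mem_nhds_iff.1 hmem
    filter_upwards [Ioo_mem_nhdsGT hε] with r hr
    exact (Metric.ball_subset_ball hr.2.le).trans hball
  have hall := (Filter.eventually_all.2 hnear).and (Ioo_mem_nhdsGT (zero_lt_one' ℝ))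
  obtain ⟨r, hr, hr01⟩ := hall.exists
  refine ⟨r, 1 / (2 * S), hr01.1, hr01.2, by positivity, fun c => ?_⟩
  have hex : ∃ σ : Fin D → Fin (m + 1),
      ‖c‖ ≤ S * |tensorEval c (fun i => interpNode m (σ i))| := by
    by_contra! hcon
    have hlt : ∀ s, ‖c s‖ ≤ ∑ σ, |A s σ| * (‖c‖ / S) := by
      intro s
      rw [hA c s, Real.norm_eq_abs]
      refine (Finset.abs_sum_le_sum_abs _ _).trans (Finset.sum_le_sum fun σ _ => ?_)
      rw [abs_mul]
      refine mul_le_mul_of_nonneg_left ?_ (abs_nonneg _)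
      rw [le_div_iff₀ hS0, mul_comm]
      exact (hcon σ).le
    have hc0 : 0 < ‖c‖ := by
      refine lt_of_le_of_lt ?_ (hcon fun _ => 0)
      positivity
    have : ‖c‖ ≤ (S - 1) * (‖c‖ / S) := by
      refine (pi_norm_le_iff_of_nonneg ?_).2 fun s => (hlt s).trans ?_
      · have : 0 ≤ S - 1 := by rw [hS, add_sub_cancel_left]; positivity
        positivity
      · rw [← Finset.sum_mul]
        refine mul_le_mul_of_nonneg_right ?_ (by positivity)
        rw [hS, add_sub_cancel_left]
        exact Finset.single_le_sum (f := fun s => ∑ σ, |A s σ|)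
          (fun s _ => Finset.sum_nonneg fun _ _ => abs_nonneg _) (Finset.mem_univ s)
    have h2 : (S - 1) * (‖c‖ / S) = ‖c‖ - ‖c‖ / S := by field_simp
    have h3 : 0 < ‖c‖ / S := by positivity
    linarith
  obtain ⟨σ, hσ⟩ := hex
  refine ⟨fun i => interpNode m (σ i), fun y hy => (hr σ hy).1,
    fun i => interpNode_mem m (σ i), fun y hy => ?_⟩
  have hdiff : |tensorEval c y - tensorEval c (fun i => interpNode m (σ i))| ≤
      ‖c‖ / (2 * S) := by
    rw [tensorEval_sub]
    calc _ ≤ ∑ s : Fin D → Fin (m + 1), ‖c‖ * (1 / (2 * S * N)) := by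
          refine (Finset.abs_sum_le_sum_abs _ _).trans (Finset.sum_le_sum fun s _ => ?_)
          rw [abs_mul]
          exact mul_le_mul (norm_le_pi_norm c s) ((hr σ hy).2 s).le (abs_nonneg _) (norm_nonneg _)
      _ = ‖c‖ / (2 * S) := by
          rw [Finset.sum_const, Finset.card_univ, nsmul_eq_mul, ← hN]
          field_simp
  have h1 : ‖c‖ / S ≤ |tensorEval c (fun i => interpNode m (σ i))| := by
    rw [div_le_iff₀ hS0, mul_comm]; exact hσ
  have h2 : ‖c‖ / S = ‖c‖ / (2 * S) + ‖c‖ / (2 * S) := by field_simp; ring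
  have h3 : 1 / (2 * S) * ‖c‖ = ‖c‖ / (2 * S) := by ring
  have h4 := abs_sub_abs_le_abs_sub (tensorEval c (fun i => interpNode m (σ i))) (tensorEval c y)
  rw [abs_sub_comm] at h4
  rw [h3]
  linarith

/-- Every polynomial of coordinate degree at most `m` is represented in the local basis. -/
theorem exists_tensorEval_eq {D m : ℕ} (M : ℕ) (l : Fin D → ℝ) (p : MvPolynomial (Fin D) ℝ)
    (hp : ∀ i, p.degreeOf i ≤ m) :
    ∃ c : (Fin D → Fin (m + 1)) → ℝ, ∀ y : Fin D → ℝ,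
      MvPolynomial.eval (fun i => (l i + y i) / M) p = tensorEval c y := by
  have h1 : ∀ (i : Fin D) (k : ℕ), k ≤ m → ∃ γ : Fin (m + 1) → ℝ,
      ∀ y : ℝ, ((l i + y) / M) ^ k = ∑ s, γ s * (cellBasis m s).eval y := by
    intro i k hk
    have hd : (((C (l i) + X) * C ((M : ℝ)⁻¹)) ^ k : ℝ[X]).natDegree ≤ m := by
      compute_degree!
    obtain ⟨γ, hγ⟩ := exists_cellBasis_coeff hd
    refine ⟨γ, fun y => ?_⟩
    have := congrArg (eval y) hγ
    simpa [eval_finsetSum, div_eq_mul_inv] using this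
  choose γ hγ using h1
  refine ⟨fun s => ∑ d ∈ p.support.attach, p.coeff d.1 * ∏ i, γ i (d.1 i)
    ((MvPolynomial.degreeOf_le_iff.1 (hp i)) d.1 d.2) (s i), fun y => ?_⟩
  unfold tensorEval
  rw [MvPolynomial.eval_eq', ← Finset.sum_attach]
  simp only [Finset.sum_mul]
  rw [Finset.sum_comm]
  refine Finset.sum_congr rfl fun d _ => ?_
  have h := Finset.prod_univ_sum (fun _ : Fin D => (Finset.univ : Finset (Fin (m + 1))))
      (fun i j => γ i (d.1 i) ((MvPolynomial.degreeOf_le_iff.1 (hp i)) d.1 d.2) j *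
        (cellBasis m j).eval (y i))
  simp only [← hγ, Fintype.piFinset_univ, Finset.prod_mul_distrib] at h
  rw [h, Finset.mul_sum]
  exact Finset.sum_congr rfl fun s _ => by ring

end TensorCell

section Matching

open Polynomial

/-- If a `C^p` function coincides with a polynomial on either side of `0`, the two polynomials have
the same coefficients up to order `p`. -/
theorem coeff_eq_of_contDiffOn {p : ℕ} {g : ℝ → ℝ} {P Q : ℝ[X]} {a b : ℝ} (ha : a < 0)
    (hb : 0 < b) (hg : ContDiffOn ℝ p g (Set.Ioo a b)) (hP : ∀ y ∈ Set.Ioo a 0, g y = P.eval y)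
    (hQ : ∀ y ∈ Set.Ioo 0 b, g y = Q.eval y) {k : ℕ} (hk : k ≤ p) : P.coeff k = Q.coeff k := by
  induction k generalizing p g P Q with
  | zero =>
    have hcont : ContinuousAt g 0 := hg.continuousOn.continuousAt (Ioo_mem_nhds ha hb)
    have h1 : g 0 = P.eval 0 := by
      refine tendsto_nhds_unique (hcont.tendsto.mono_left nhdsWithin_le_nhds)
        ((P.continuous.tendsto 0).mono_left (nhdsWithin_le_nhds (s := Set.Iio 0)) |>.congr' ?_)
      filter_upwards [Ioo_mem_nhdsLT ha] with y hy using (hP y hy).symm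
    have h2 : g 0 = Q.eval 0 := by
      refine tendsto_nhds_unique (hcont.tendsto.mono_left nhdsWithin_le_nhds)
        ((Q.continuous.tendsto 0).mono_left (nhdsWithin_le_nhds (s := Set.Ioi 0)) |>.congr' ?_)
      filter_upwards [Ioo_mem_nhdsGT hb] with y hy using (hQ y hy).symm
    rw [coeff_zero_eq_eval_zero, coeff_zero_eq_eval_zero, ← h1, h2]
  | succ k ih =>
    obtain ⟨p, rfl⟩ : ∃ q, p = q + 1 := ⟨p - 1, by omega⟩
    have hd : ContDiffOn ℝ p (deriv g) (Set.Ioo a b) := by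
      push_cast at hg
      exact ((contDiffOn_succ_iff_deriv_of_isOpen isOpen_Ioo).1 hg).2.2
    have h := ih (P := derivative P) (Q := derivative Q) hd (fun y hy => ?_) (fun y hy => ?_)
      (by omega)
    · rw [coeff_derivative, coeff_derivative] at h
      exact mul_right_cancel₀ (by positivity) h
    · rw [← Polynomial.deriv]
      refine Filter.EventuallyEq.deriv_eq ?_
      filter_upwards [Ioo_mem_nhds hy.1 hy.2] with w hw using hP w hw
    · rw [← Polynomial.deriv]
      refine Filter.EventuallyEq.deriv_eq ?_
      filter_upwards [Ioo_mem_nhds hy.1 hy.2] with w hw using hQ w hw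

/-- The coefficients of a tensor-product polynomial along a line in direction `i`. -/
def sliceCoeff {D m : ℕ} (c : (Fin D → Fin (m + 1)) → ℝ) (i : Fin D) (z : Fin D → ℝ)
    (r : Fin (m + 1)) : ℝ :=
  ∑ s with s i = r, c s * ∏ j ∈ Finset.univ.erase i, (cellBasis m (s j)).eval (z j)

theorem tensorEval_update {D m : ℕ} (c : (Fin D → Fin (m + 1)) → ℝ) (i : Fin D)
    (z : Fin D → ℝ) (y : ℝ) :
    tensorEval c (Function.update z i y) = (∑ r, sliceCoeff c i z r • cellBasis m r).eval y := by
  rw [eval_finsetSum, tensorEval, ← Finset.sum_fiberwise (g := fun s : Fin D → Fin (m + 1) => s i)]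
  refine Finset.sum_congr rfl fun r _ => ?_
  rw [eval_smul, smul_eq_mul, sliceCoeff, Finset.sum_mul]
  refine Finset.sum_congr rfl fun s hs => ?_
  have hs' : s i = r := (Finset.mem_filter.1 hs).2
  rw [← Finset.mul_prod_erase _ _ (Finset.mem_univ i), Function.update_self, hs',
    Finset.prod_congr rfl fun j hj => by
      rw [Function.update_of_ne (Finset.ne_of_mem_erase hj)]]
  ring

theorem sliceCoeff_eq {D m : ℕ} (c : (Fin D → Fin (m + 1)) → ℝ) (i : Fin D) (z : Fin D → ℝ)
    (r : Fin (m + 1)) :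
    sliceCoeff c i z r = ∑ s with s i = (0 : Fin (m + 1)), c (Function.update s i r) *
      ∏ j ∈ Finset.univ.erase i, (cellBasis m (s j)).eval (z j) := by
  refine Finset.sum_bij' (fun s _ => Function.update s i 0) (fun s _ => Function.update s i r)
    (by simp) (by simp) ?_ ?_ ?_
  · intro s hs
    simp only [Finset.mem_filter, Finset.mem_univ, true_and] at hs
    simp [← hs]
  · intro s hs
    simp only [Finset.mem_filter, Finset.mem_univ, true_and] at hs
    simp [← hs]
  · intro s hs
    simp only [Finset.mem_filter, Finset.mem_univ, true_and] at hs
    congr 1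
    · simp [← hs]
    · exact Finset.prod_congr rfl fun j hj => by
        rw [Function.update_of_ne (Finset.ne_of_mem_erase hj)]

/-- Equality of tensor coefficients from equality of the slice coefficients at all nodes. -/
theorem coeff_eq_of_sliceCoeff_eq {D m : ℕ} {c c' : (Fin D → Fin (m + 1)) → ℝ} {i : Fin D}
    {r r' : Fin (m + 1)}
    (h : ∀ σ : Fin D → Fin (m + 1), sliceCoeff c i (fun j => interpNode m (σ j)) r =
      sliceCoeff c' i (fun j => interpNode m (σ j)) r') (s : Fin D → Fin (m + 1)) :
    c (Function.update s i r) = c' (Function.update s i r') := by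
  obtain ⟨A, hA⟩ := exists_dual_tensorEval D m
  set e : (Fin D → Fin (m + 1)) → ℝ := fun s =>
    if s i = 0 then c (Function.update s i r) - c' (Function.update s i r') else 0 with he
  have hz : ∀ σ : Fin D → Fin (m + 1), tensorEval e (fun j => interpNode m (σ j)) = 0 := by
    intro σ
    have h0 := h σ
    rw [sliceCoeff_eq, sliceCoeff_eq, ← sub_eq_zero, ← Finset.sum_sub_distrib] at h0
    rw [tensorEval]
    calc _ = ∑ s with s i = (0 : Fin (m + 1)), (c (Function.update s i r) -
          c' (Function.update s i r')) * ∏ j, (cellBasis m (s j)).eval (interpNode m (σ j)) := by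
            rw [Finset.sum_filter]
            refine Finset.sum_congr rfl fun s _ => ?_
            simp only [he]
            split_ifs <;> simp
      _ = (∑ s with s i = (0 : Fin (m + 1)), (c (Function.update s i r) *
            ∏ j ∈ Finset.univ.erase i, (cellBasis m (s j)).eval (interpNode m (σ j)) -
          c' (Function.update s i r') *
            ∏ j ∈ Finset.univ.erase i, (cellBasis m (s j)).eval (interpNode m (σ j)))) *
          (cellBasis m 0).eval (interpNode m (σ i)) := by
            rw [Finset.sum_mul]
            refine Finset.sum_congr rfl fun s hs => ?_
            rw [← Finset.mul_prod_erase _ _ (Finset.mem_univ i), (Finset.mem_filter.1 hs).2]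
            ring
      _ = 0 := by rw [h0, zero_mul]
  have hs := hA e (Function.update s i 0)
  simp only [hz, mul_zero, Finset.sum_const_zero] at hs
  simpa [he, sub_eq_zero] using hs

end Matching

section SplineCoefficients

open Polynomial

/-- Local coordinates of a point with respect to the cell of multi-index `l`. -/
def localCoord {D M : ℕ} (l : Fin D → Fin M) (x : Fin D → ℝ) (i : Fin D) : ℝ :=
  M * x i - (l i : ℕ)

theorem mem_cell_iff {D M : ℕ} (hM : 0 < M) (l : Fin D → Fin M) (x : Fin D → ℝ) :
    x ∈ cell D M l ↔ ∀ i, localCoord l x i ∈ Set.Ico (0 : ℝ) 1 := by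
  have hM' : (0 : ℝ) < M := by exact_mod_cast hM
  refine forall_congr' fun i => ?_
  rw [div_le_iff₀ hM', lt_div_iff₀ hM', localCoord, Set.mem_Ico, sub_nonneg, sub_lt_iff_lt_add',
    mul_comm]

theorem IsSpline.exists_coeff {D M p : ℕ} (hM : 0 < M) {u : (Fin D → ℝ) → ℝ}
    (hu : IsSpline D M (p + 2) u) :
    ∃ c : (Fin D → Fin M) → (Fin D → Fin (p + 1 + 1)) → ℝ,
      ∀ l, ∀ x ∈ cell D M l, u x = tensorEval (c l) (localCoord l x) := by
  have hM' : (M : ℝ) ≠ 0 := by exact_mod_cast hM.ne'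
  have h : ∀ l : Fin D → Fin M, ∃ c : (Fin D → Fin (p + 1 + 1)) → ℝ,
      ∀ x ∈ cell D M l, u x = tensorEval c (localCoord l x) := by
    intro l
    obtain ⟨P, hP, hPu⟩ := hu.2 l
    obtain ⟨c, hc⟩ := exists_tensorEval_eq (m := p + 1) M (fun i => ((l i : ℕ) : ℝ)) P hP
    refine ⟨c, fun x hx => ?_⟩
    rw [hPu x hx, ← hc]
    congr 2
    funext i
    rw [localCoord]
    field_simp
    ring
  choose c hc using h
  exact ⟨c, hc⟩

/-- Coefficients of a spline on adjacent cells agree for the B-splines active on both. -/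
theorem IsSpline.coeff_adjacent {D M p : ℕ} {u : (Fin D → ℝ) → ℝ}
    (hu : IsSpline D M (p + 2) u) {c : (Fin D → Fin M) → (Fin D → Fin (p + 1 + 1)) → ℝ}
    (hc : ∀ l, ∀ x ∈ cell D M l, u x = tensorEval (c l) (localCoord l x))
    {l l' : Fin D → Fin M} {i : Fin D} (hi : (l' i : ℕ) = l i + 1) (hl : ∀ j ≠ i, l' j = l j)
    (s : Fin D → Fin (p + 1 + 1)) (r : Fin (p + 1)) :
    c l' (Function.update s i r.castSucc) = c l (Function.update s i r.succ) := by
  have hM : 0 < M := (Nat.zero_le _).trans_lt (l i).2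
  have hM' : (0 : ℝ) < M := by exact_mod_cast hM
  refine coeff_eq_of_sliceCoeff_eq (fun σ => ?_) s
  set z : Fin D → ℝ := fun j => interpNode (p + 1) (σ j) with hz
  have hzmem : ∀ j, z j ∈ Set.Ioo (0 : ℝ) 1 := fun j => interpNode_mem _ _
  set w : ℝ → Fin D → ℝ := fun y =>
    Function.update (fun j => (((l j : ℕ) : ℝ) + z j) / M) i ((((l i : ℕ) : ℝ) + 1 + y) / M) with hw
  have hloc : ∀ y, localCoord l (w y) = Function.update z i (y + 1) := by
    intro y
    funext j
    by_cases hj : j = i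
    · subst hj
      simp only [localCoord, hw, Function.update_self]
      field_simp
      ring
    · simp only [localCoord, hw, Function.update_of_ne hj]
      field_simp
      ring
  have hloc' : ∀ y, localCoord l' (w y) = Function.update z i y := by
    intro y
    funext j
    by_cases hj : j = i
    · subst hj
      simp only [localCoord, hw, Function.update_self, hi]
      push_cast
      field_simp
      ring
    · simp only [localCoord, hw, Function.update_of_ne hj, hl j hj]
      field_simp
      ring
  set P : ℝ[X] := (∑ r, sliceCoeff (c l) i z r • cellBasis (p + 1) r).comp (X + 1) with hP
  set Q : ℝ[X] := ∑ r, sliceCoeff (c l') i z r • cellBasis (p + 1) r with hQ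
  have huP : ∀ y ∈ Set.Ioo (-1 : ℝ) 0, u (w y) = P.eval y := by
    intro y hy
    rw [hc l (w y), hloc, tensorEval_update, hP, eval_comp, eval_add, eval_X, eval_one]
    rw [mem_cell_iff hM, hloc]
    intro j
    by_cases hj : j = i
    · subst hj
      rw [Function.update_self]
      exact ⟨by linarith [hy.1], by linarith [hy.2]⟩
    · rw [Function.update_of_ne hj]
      exact ⟨(hzmem j).1.le, (hzmem j).2⟩
  have huQ : ∀ y ∈ Set.Ioo (0 : ℝ) 1, u (w y) = Q.eval y := by
    intro y hy
    rw [hc l' (w y), hloc', tensorEval_update]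
    rw [mem_cell_iff hM, hloc']
    intro j
    by_cases hj : j = i
    · subst hj
      rw [Function.update_self]
      exact ⟨hy.1.le, hy.2⟩
    · rw [Function.update_of_ne hj]
      exact ⟨(hzmem j).1.le, (hzmem j).2⟩
  have hmaps : ∀ y ∈ Set.Ioo (-1 : ℝ) 1, w y ∈ unitCube D := by
    intro y hy j
    by_cases hj : j = i
    · subst hj
      simp only [hw, Function.update_self]
      have h2 : ((l j : ℕ) : ℝ) + 2 ≤ M := by
        have := (l' j).2
        exact_mod_cast (by omega : (l j : ℕ) + 2 ≤ M)
      refine ⟨div_pos (by linarith [hy.1, (Nat.cast_nonneg (l j : ℕ) : (0 : ℝ) ≤ _)]) hM', ?_⟩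
      rw [div_lt_one hM']
      linarith [hy.2]
    · simp only [hw, Function.update_of_ne hj]
      have h2 : ((l j : ℕ) : ℝ) + 1 ≤ M := by exact_mod_cast (l j).2
      refine ⟨div_pos (by have := (hzmem j).1; positivity) hM', ?_⟩
      rw [div_lt_one hM']
      linarith [(hzmem j).2]
  have hsmooth : ContDiffOn ℝ p (fun y => u (w y)) (Set.Ioo (-1) 1) := by
    have hu1 : ContDiffOn ℝ p u (unitCube D) := hu.1
    refine hu1.comp (ContDiff.contDiffOn ?_) hmaps
    rw [contDiff_pi]
    intro j
    by_cases hj : j = i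
    · subst hj
      simp only [hw, Function.update_self]
      fun_prop
    · simp only [hw, Function.update_of_ne hj]
      fun_prop
  have hcoeff : ∀ k ≤ p, P.coeff k = Q.coeff k := fun k hk =>
    coeff_eq_of_contDiffOn (by norm_num) one_pos hsmooth huP huQ hk
  have hdeg : ∀ c' : Fin (p + 1 + 1) → ℝ,
      (∑ r, c' r • cellBasis (p + 1) r).natDegree ≤ p + 1 := by
    intro c'
    refine natDegree_sum_le_of_forall_le _ _ fun r _ => (natDegree_smul_le _ _).trans ?_
    have := mem_degreeLT.1 (cellBasis_mem (p + 1) r)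
    exact natDegree_le_iff_coeff_eq_zero.2 fun N hN => (degree_lt_iff_coeff_zero _ _).1 this N hN
  refine cellBasis_coeff_shift (κ := Q.coeff (p + 1) - P.coeff (p + 1)) ?_ r
  rw [← hP, ← hQ]
  ext k
  rw [coeff_sub, coeff_C_mul, coeff_X_pow]
  rcases lt_trichotomy k (p + 1) with hk | hk | hk
  · rw [hcoeff k (by omega), if_neg hk.ne]
    simp
  · simp [hk]
  · rw [coeff_eq_zero_of_natDegree_lt ((hdeg _).trans_lt hk), coeff_eq_zero_of_natDegree_lt,
      if_neg hk.ne']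
    · simp
    · refine lt_of_le_of_lt ?_ hk
      rw [hP, natDegree_comp]
      have : (X + 1 : ℝ[X]).natDegree = 1 := natDegree_X_add_C 1
      rw [this, mul_one]
      exact hdeg _

end SplineCoefficients

section GlobalBSplines

open Polynomial

/-- The local coefficients of a spline come from a single family of B-spline coefficients. -/
theorem IsSpline.exists_global_coeff {D M p : ℕ} {u : (Fin D → ℝ) → ℝ}
    (hu : IsSpline D M (p + 2) u) {c : (Fin D → Fin M) → (Fin D → Fin (p + 1 + 1)) → ℝ}
    (hM : 0 < M) (hc : ∀ l, ∀ x ∈ cell D M l, u x = tensorEval (c l) (localCoord l x)) :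
    ∃ G : (Fin D → ℕ) → ℝ, ∀ l s, c l s = G (fun i => (l i : ℕ) + (s i : ℕ)) := by
  refine ⟨fun a => c (fun i => ⟨min (a i) (M - 1), by omega⟩)
    (fun i => ⟨min (a i - (M - 1)) (p + 1), by omega⟩), ?_⟩
  have key : ∀ (N : ℕ) (l : Fin D → Fin M) (s : Fin D → Fin (p + 1 + 1)),
      ∑ i, (s i : ℕ) = N → c l s =
        c (fun i => ⟨min ((l i : ℕ) + (s i : ℕ)) (M - 1), by omega⟩)
          (fun i => ⟨min ((l i : ℕ) + (s i : ℕ) - (M - 1)) (p + 1), by omega⟩) := by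
    intro N
    induction N with
    | zero =>
      intro l s hs
      have hs0 : ∀ i, (s i : ℕ) = 0 := by simpa using hs
      congr 1
      · funext i
        ext
        have := (l i).2
        simp only [hs0 i]
        omega
      · funext i
        ext
        have := (l i).2
        simp only [hs0 i]
        omega
    | succ N ih =>
      intro l s hs
      by_cases hex : ∃ i, 0 < (s i : ℕ) ∧ (l i : ℕ) + 1 < M
      · obtain ⟨i, hi, hli⟩ := hex
        have hr : (s i : ℕ) - 1 < p + 1 := by have := (s i).2; omega
        set r : Fin (p + 1) := ⟨(s i : ℕ) - 1, hr⟩ with hrdef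
        set l' : Fin D → Fin M := Function.update l i ⟨(l i : ℕ) + 1, hli⟩ with hl'
        have hadj := hu.coeff_adjacent hc (l := l) (l' := l') (i := i) (by simp [hl'])
          (fun j hj => by simp [hl', Function.update_of_ne hj]) s r
        have hsr : r.succ = s i := by ext; simp [hrdef]; omega
        rw [hsr, Function.update_eq_self] at hadj
        have hsum : ∑ j, ((Function.update s i r.castSucc) j : ℕ) = N := by
          rw [← Finset.add_sum_erase _ _ (Finset.mem_univ i)] at hs ⊢
          rw [Finset.sum_congr rfl fun j hj => by
            rw [Function.update_of_ne (Finset.ne_of_mem_erase hj)]]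
          simp [hrdef]
          omega
        have hadd : ∀ j, (l' j : ℕ) + ((Function.update s i r.castSucc) j : ℕ) =
            (l j : ℕ) + (s j : ℕ) := by
          intro j
          by_cases hj : j = i
          · subst hj
            simp [hl', hrdef]
            omega
          · simp [hl', Function.update_of_ne hj]
        rw [← hadj, ih l' _ hsum]
        simp only [hadd]
      · push Not at hex
        congr 1
        · funext i
          ext
          have h1 := (l i).2
          have h2 := hex i
          simp only
          omega
        · funext i
          ext
          have h1 := (l i).2
          have h2 := hex i
          have h3 := (s i).2
          simp only
          omega
  exact fun l s => key _ l s rfl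

/-- The linear combination of tensor-product B-splines of degree `m` on the grid of size `1 / M`
with coefficients `H`. -/
def bsplineSum (D M m : ℕ) (H : (Fin D → ℕ) → ℝ) (x : Fin D → ℝ) : ℝ :=
  ∑ a : Fin D → Fin (M + m), H (fun i => a i) *
    ∏ i, cardinalBSpline m (M * x i - (a i : ℕ) + m)

theorem bsplineSum_cell {D M m : ℕ} (hM : 0 < M) (hm : m ≠ 0) (H : (Fin D → ℕ) → ℝ)
    (l : Fin D → Fin M) {x : Fin D → ℝ} (hx : x ∈ cell D M l) :
    bsplineSum D M m H x =
      tensorEval (m := m) (fun s => H fun i => (l i : ℕ) + (s i : ℕ)) (localCoord l x) := by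
  have hy := (mem_cell_iff hM l x).1 hx
  have hval : ∀ (a : Fin D → Fin (M + m)) (i : Fin D),
      cardinalBSpline m (M * x i - (a i : ℕ) + m) =
        if h : (l i : ℕ) ≤ a i ∧ (a i : ℕ) < l i + (m + 1) then
          (cellBasis m ⟨(a i : ℕ) - l i, by omega⟩).eval (localCoord l x i) else 0 := by
    intro a i
    rw [← cardinalBSpline_cell m (l i) (a i) hm (hy i)]
    congr 1
    rw [localCoord]
    ring
  have hlt : ∀ (i : Fin D) (s : Fin (m + 1)), (l i : ℕ) + (s : ℕ) < M + m := by
    intro i s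
    have := (l i).2
    have := s.2
    omega
  rw [bsplineSum, tensorEval]
  symm
  refine Finset.sum_of_injOn (fun s i => ⟨(l i : ℕ) + (s i : ℕ), hlt i (s i)⟩) ?_
    (fun _ _ => Finset.mem_coe.2 (Finset.mem_univ _)) ?_ ?_
  · intro s _ s' _ h
    funext i
    ext
    have := congrArg Fin.val (congrFun h i)
    simpa using this
  · intro a _ ha
    have : ∃ i, ¬ ((l i : ℕ) ≤ a i ∧ (a i : ℕ) < l i + (m + 1)) := by
      by_contra! hcon
      refine ha ⟨fun i => ⟨(a i : ℕ) - l i, by have := hcon i; omega⟩,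
        Finset.mem_coe.2 (Finset.mem_univ _), ?_⟩
      funext i
      ext
      have := hcon i
      simp only
      omega
    obtain ⟨i, hi⟩ := this
    rw [Finset.prod_eq_zero (Finset.mem_univ i), mul_zero]
    rw [hval, dif_neg hi]
  · intro s _
    congr 1
    refine Finset.prod_congr rfl fun i _ => ?_
    rw [hval (fun i => ⟨(l i : ℕ) + (s i : ℕ), hlt i (s i)⟩) i,
      dif_pos ⟨by simp, by have := (s i).2; simp; omega⟩]
    congr 2
    ext
    simp

theorem degreeOf_aeval_X_le {σ : Type*} [DecidableEq σ] (i j : σ) (q : ℝ[X]) :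
    (aeval (MvPolynomial.X j : MvPolynomial σ ℝ) q).degreeOf i ≤
      if i = j then q.natDegree else 0 := by
  rw [aeval_eq_sum_range]
  refine (MvPolynomial.degreeOf_sum_le _ _ _).trans (Finset.sup_le fun k hk => ?_)
  rw [MvPolynomial.smul_eq_C_mul]
  refine (MvPolynomial.degreeOf_C_mul_le _ _ _).trans ?_
  refine (MvPolynomial.degreeOf_pow_le _ _ _).trans ?_
  rw [MvPolynomial.degreeOf_X]
  split_ifs
  · simpa [Nat.lt_succ_iff] using hk
  · simp

theorem exists_mvPolynomial_tensorEval {D M m : ℕ} (l : Fin D → Fin M)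
    (c : (Fin D → Fin (m + 1)) → ℝ) : ∃ P : MvPolynomial (Fin D) ℝ,
      (∀ i, P.degreeOf i ≤ m) ∧ ∀ x, tensorEval c (localCoord l x) = MvPolynomial.eval x P := by
  set q : Fin D → Fin (m + 1) → ℝ[X] := fun i s =>
    (cellBasis m s).comp (C (M : ℝ) * X - C ((l i : ℕ) : ℝ)) with hq
  have hdeg : ∀ i s, (q i s).natDegree ≤ m := by
    intro i s
    have h1 : (cellBasis m s).natDegree ≤ m :=
      natDegree_le_iff_coeff_eq_zero.2 fun N hN =>
        (degree_lt_iff_coeff_zero _ _).1 (mem_degreeLT.1 (cellBasis_mem m s)) N hN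
    have h2 : (C (M : ℝ) * X - C ((l i : ℕ) : ℝ)).natDegree ≤ 1 := by compute_degree
    exact natDegree_comp_le.trans ((Nat.mul_le_mul h1 h2).trans (mul_one m).le)
  refine ⟨∑ s, MvPolynomial.C (c s) * ∏ i, aeval (MvPolynomial.X i) (q i (s i)),
    fun i => ?_, fun x => ?_⟩
  · refine (MvPolynomial.degreeOf_sum_le _ _ _).trans (Finset.sup_le fun s _ => ?_)
    refine (MvPolynomial.degreeOf_C_mul_le _ _ _).trans ?_
    refine (MvPolynomial.degreeOf_prod_le _ _ _).trans ?_
    refine (Finset.sum_le_sum fun j _ => degreeOf_aeval_X_le i j (q j (s j))).trans ?_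
    rw [Finset.sum_ite_eq, if_pos (Finset.mem_univ i)]
    exact hdeg i (s i)
  · rw [tensorEval, map_sum]
    refine Finset.sum_congr rfl fun s _ => ?_
    rw [map_mul, MvPolynomial.eval_C, map_prod]
    congr 1
    refine Finset.prod_congr rfl fun i _ => ?_
    have h : MvPolynomial.eval x (aeval (MvPolynomial.X i) (q i (s i))) =
        (q i (s i)).eval (x i) := by
      rw [← MvPolynomial.coe_aeval_eq_eval, RingHom.coe_coe, ← aeval_algHom_apply,
        MvPolynomial.aeval_X, coe_aeval_eq_eval]
    rw [h, hq]
    simp [eval_comp, localCoord]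

theorem isSpline_bsplineSum {D M p : ℕ} (hM : 0 < M) (H : (Fin D → ℕ) → ℝ) :
    IsSpline D M (p + 2) (bsplineSum D M (p + 1) H) := by
  refine ⟨ContDiff.contDiffOn ?_, fun l => ?_⟩
  · refine ContDiff.sum fun a _ => contDiff_const.mul (contDiff_prod fun i _ => ?_)
    refine (contDiff_cardinalBSpline p).comp ?_
    fun_prop
  · obtain ⟨P, hP, hPx⟩ := exists_mvPolynomial_tensorEval l
      (fun s : Fin D → Fin (p + 1 + 1) => H fun i => (l i : ℕ) + (s i : ℕ))
    exact ⟨P, hP, fun x hx => by rw [bsplineSum_cell hM (by omega) H l hx, hPx]⟩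

end GlobalBSplines

section Flow

/-- A differential inequality of Grönwall type on `[0, S]`. -/
theorem le_mul_exp_of_deriv_le {g g' : ℝ → ℝ} {c S : ℝ} (hg : ∀ s, HasDerivAt g (g' s) s)
    (hle : ∀ s ∈ Set.Icc 0 S, g' s ≤ c * g s) {s : ℝ} (hs : s ∈ Set.Icc 0 S) :
    g s ≤ g 0 * Real.exp (c * s) := by
  have hder : ∀ s, HasDerivAt (fun s => g s * Real.exp (-(c * s)))
      (g' s * Real.exp (-(c * s)) + g s * (Real.exp (-(c * s)) * -(c * 1))) s := fun s =>
    (hg s).mul (((hasDerivAt_id s).const_mul c).neg.exp)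
  have hanti : AntitoneOn (fun s => g s * Real.exp (-(c * s))) (Set.Icc 0 S) := by
    refine antitoneOn_of_deriv_nonpos (convex_Icc 0 S)
      (fun s _ => (hder s).continuousAt.continuousWithinAt)
      (fun s _ => (hder s).differentiableAt.differentiableWithinAt) fun s hs => ?_
    rw [interior_Icc] at hs
    rw [(hder s).deriv]
    have := mul_nonneg (sub_nonneg.2 (hle s (Set.Ioo_subset_Icc_self hs)))
      (Real.exp_pos (-(c * s))).le
    nlinarith
  have h := hanti ⟨le_rfl, hs.1.trans hs.2⟩ hs hs.1
  simp only [mul_zero, neg_zero, Real.exp_zero, mul_one] at h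
  calc g s = g s * Real.exp (-(c * s)) * Real.exp (c * s) := by
        rw [mul_assoc, ← Real.exp_add, neg_add_cancel, Real.exp_zero, mul_one]
    _ ≤ g 0 * Real.exp (c * s) := mul_le_mul_of_nonneg_right h (Real.exp_pos _).le

/-- A trajectory of a locally Lipschitz field tangent to the faces of the closed unit cube which
starts in the half-open unit cube stays there. -/
theorem trajectory_mem_Ico {D : ℕ} {V : ℝ → (Fin D → ℝ) → Fin D → ℝ} {γ : ℝ → Fin D → ℝ} {S : ℝ}
    (hS : 0 ≤ S) (hγ : ∀ s, HasDerivAt γ (V s (γ s)) s)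
    (hV : ∀ ρ : ℝ, ∃ L : ℝ≥0, ∀ s ∈ Set.Icc 0 S, LipschitzOnWith L (V s) (Metric.closedBall 0 ρ))
    (htan : ∀ s ∈ Set.Icc 0 S, ∀ x : Fin D → ℝ, (∀ i, x i ∈ Set.Icc (0 : ℝ) 1) →
      ∀ i, (x i = 0 ∨ x i = 1) → V s x i = 0)
    (h0 : ∀ i, γ 0 i ∈ Set.Ico (0 : ℝ) 1) (i : Fin D) : γ S i ∈ Set.Ico (0 : ℝ) 1 := by
  have hcont : Continuous γ := continuous_iff_continuousAt.2 fun s => (hγ s).continuousAt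
  have hγi : ∀ i s, HasDerivAt (fun s => γ s i) (V s (γ s) i) s := fun i s =>
    hasDerivAt_pi.1 (hγ s) i
  obtain ⟨ρ, hρ⟩ := (isCompact_Icc.image (s := Set.Icc 0 S) hcont).isBounded.subset_closedBall 0
  obtain ⟨L, hL⟩ := hV (max ρ 1)
  have hball : ∀ s ∈ Set.Icc 0 S, γ s ∈ Metric.closedBall 0 (max ρ 1) := fun s hs =>
    Metric.closedBall_subset_closedBall (le_max_left _ _) (hρ (Set.mem_image_of_mem γ hs))
  have hcube : ∀ x : Fin D → ℝ, (∀ i, x i ∈ Set.Icc (0 : ℝ) 1) →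
      x ∈ Metric.closedBall 0 (max ρ 1) := by
    intro x hx
    rw [mem_closedBall_zero_iff, pi_norm_le_iff_of_nonneg (by positivity)]
    intro i
    rw [Real.norm_eq_abs, abs_of_nonneg (hx i).1]
    exact (hx i).2.trans (le_max_right _ _)
  have hbound : ∀ s ∈ Set.Icc 0 S, ∀ x : Fin D → ℝ, (∀ i, x i ∈ Set.Icc (0 : ℝ) 1) →
      ∀ i, (x i = 0 ∨ x i = 1) → |V s (γ s) i| ≤ L * ‖γ s - x‖ := by
    intro s hs x hx i hi
    have h1 := (hL s hs).dist_le_mul _ (hball s hs) x (hcube x hx)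
    rw [dist_eq_norm, dist_eq_norm] at h1
    have h2 := (norm_le_pi_norm (V s (γ s) - V s x) i).trans h1
    rwa [Pi.sub_apply, htan s hs x hx i hi, sub_zero] at h2
  set φ : ℝ → ℝ := fun y => (max (-y) 0) ^ 2 + (max (y - 1) 0) ^ 2 with hφ
  set φ' : ℝ → ℝ := fun y => -(2 * max (-y) 0) + 2 * max (y - 1) 0 with hφ'
  have hφd : ∀ y, HasDerivAt φ (φ' y) y := by
    intro y
    have h1 := (hasDerivAt_max_zero_pow 0 (-y)).comp y (hasDerivAt_neg y)
    have h2 := (hasDerivAt_max_zero_pow 0 (y - 1)).comp y ((hasDerivAt_id y).sub_const 1)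
    refine (h1.add h2).congr_deriv ?_
    simp [hφ']
  have hψ : ∀ s, HasDerivAt (fun s => ∑ i, φ (γ s i)) (∑ i, φ' (γ s i) * V s (γ s) i) s := fun s =>
    HasDerivAt.fun_sum fun i _ => (hφd _).comp s (hγi i s)
  have hφ0 : ∀ y, 0 ≤ φ y := fun y => by positivity
  have hψle : ∀ s ∈ Set.Icc 0 S, ∑ i, φ' (γ s i) * V s (γ s) i ≤
      (D * (2 * L)) * ∑ i, φ (γ s i) := by
    intro s hs
    set x : Fin D → ℝ := fun i => max 0 (min (γ s i) 1) with hx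
    have hxc : ∀ i, x i ∈ Set.Icc (0 : ℝ) 1 := fun i =>
      ⟨le_max_left _ _, max_le zero_le_one (min_le_right _ _)⟩
    have hsq : ∀ i, |γ s i - x i| ^ 2 = φ (γ s i) ∧ |φ' (γ s i)| = 2 * |γ s i - x i| ∧
        (γ s i - x i ≠ 0 → x i = 0 ∨ x i = 1) := by
      intro i
      simp only [hx, hφ, hφ']
      generalize γ s i = y
      rcases le_total y 0 with h | h
      · rw [min_eq_left (by linarith), max_eq_left h, max_eq_left (by linarith : (0 : ℝ) ≤ -y),
          max_eq_right (by linarith)]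
        refine ⟨by rw [sq_abs]; ring, ?_, fun _ => Or.inl rfl⟩
        rw [abs_of_nonpos (by linarith : y - 0 ≤ 0), abs_of_nonpos (by linarith)]
        ring
      · rcases le_total y 1 with h' | h'
        · rw [min_eq_left h', max_eq_right h, max_eq_right (by linarith : -y ≤ 0),
            max_eq_right (by linarith)]
          simp
        · rw [min_eq_right h', max_eq_right zero_le_one, max_eq_right (by linarith : -y ≤ 0),
            max_eq_left (by linarith)]
          refine ⟨by rw [sq_abs]; ring, ?_, fun _ => Or.inr rfl⟩
          rw [abs_of_nonneg (by linarith : 0 ≤ y - 1), abs_of_nonneg (by linarith)]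
          ring
    set Ψ := ∑ i, φ (γ s i) with hΨ
    have hΨ0 : 0 ≤ Ψ := Finset.sum_nonneg fun i _ => hφ0 _
    have hδi : ∀ i, |γ s i - x i| ≤ √Ψ := by
      intro i
      refine Real.le_sqrt_of_sq_le ?_
      rw [(hsq i).1]
      exact Finset.single_le_sum (f := fun i => φ (γ s i)) (fun i _ => hφ0 _) (Finset.mem_univ i)
    have hδ : ‖γ s - x‖ ≤ √Ψ := (pi_norm_le_iff_of_nonneg (Real.sqrt_nonneg _)).2 hδi
    have hterm : ∀ i, φ' (γ s i) * V s (γ s) i ≤ 2 * L * Ψ := by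
      intro i
      refine (le_abs_self _).trans ?_
      rw [abs_mul, (hsq i).2.1]
      by_cases hne : γ s i - x i = 0
      · rw [hne]
        simp only [abs_zero, mul_zero, zero_mul]
        positivity
      · calc 2 * |γ s i - x i| * |V s (γ s) i|
            ≤ 2 * √Ψ * (L * √Ψ) := by
              have := hbound s hs x hxc i ((hsq i).2.2 hne)
              have := hδi i
              gcongr
              exact (hbound s hs x hxc i ((hsq i).2.2 hne)).trans (by gcongr)
          _ = 2 * L * Ψ := by linear_combination 2 * L * Real.mul_self_sqrt hΨ0
    calc ∑ i, φ' (γ s i) * V s (γ s) i ≤ ∑ _i : Fin D, 2 * L * Ψ :=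
          Finset.sum_le_sum fun i _ => hterm i
      _ = (D * (2 * L)) * Ψ := by simp [mul_assoc]
  have hIcc : ∀ s ∈ Set.Icc 0 S, ∀ i, γ s i ∈ Set.Icc (0 : ℝ) 1 := by
    intro s hs i
    have h := le_mul_exp_of_deriv_le hψ hψle hs
    have hz : ∑ i, φ (γ 0 i) = 0 := by
      refine Finset.sum_eq_zero fun i _ => ?_
      simp only [hφ]
      rw [max_eq_right (by linarith [(h0 i).1]), max_eq_right (by linarith [(h0 i).2])]
      simp
    rw [hz, zero_mul] at h
    have hi := (Finset.single_le_sum (f := fun i => φ (γ s i)) (fun i _ => hφ0 _)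
      (Finset.mem_univ i)).trans h
    simp only [hφ] at hi
    have h1 : (max (-γ s i) 0) ^ 2 = 0 := le_antisymm (by nlinarith [sq_nonneg (max (γ s i - 1) 0)])
      (sq_nonneg _)
    have h2 : (max (γ s i - 1) 0) ^ 2 = 0 := le_antisymm (by nlinarith [sq_nonneg (max (-γ s i) 0)])
      (sq_nonneg _)
    rw [sq_eq_zero_iff, max_eq_right_iff] at h1 h2
    exact ⟨by linarith, by linarith⟩
  have hSS : S ∈ Set.Icc 0 S := ⟨hS, le_rfl⟩
  refine ⟨(hIcc S hSS i).1, ?_⟩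
  have hlt := le_mul_exp_of_deriv_le (g := fun s => γ s i - 1) (c := -L)
    (fun s => (hγi i s).sub_const 1) (fun s hs => ?_) hSS
  · have := mul_neg_of_neg_of_pos (sub_neg.2 (h0 i).2) (Real.exp_pos (-(L : ℝ) * S))
    linarith
  · have hx : ∀ i', Function.update (γ s) i 1 i' ∈ Set.Icc (0 : ℝ) 1 := by
      intro i'
      rcases eq_or_ne i' i with rfl | hne
      · simp
      · simpa [hne] using hIcc s hs i'
    have h := hbound s hs _ hx i (Or.inr (by simp))
    have hn : ‖γ s - Function.update (γ s) i 1‖ ≤ 1 - γ s i := by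
      rw [pi_norm_le_iff_of_nonneg (by linarith [(hIcc s hs i).2])]
      intro i'
      rcases eq_or_ne i' i with rfl | hne
      · simp only [Pi.sub_apply, Function.update_self, Real.norm_eq_abs]
        rw [abs_of_nonpos (by linarith [(hIcc s hs i').2])]
        linarith
      · simpa [hne] using (hIcc s hs i).2
    calc V s (γ s) i ≤ L * (1 - γ s i) := (le_abs_self _).trans (h.trans (by gcongr))
      _ = -L * (γ s i - 1) := by ring

variable {D : ℕ} {T : ℝ}

theorem FlowData.exists_lipschitzOnWith (F : FlowData D T) (ρ : ℝ) :
    ∃ L : ℝ≥0, ∀ t ∈ Set.Icc 0 T, LipschitzOnWith L (fun x => F.a x t) (Metric.closedBall 0 ρ) := by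
  have hl : LocallyLipschitzOn (Metric.closedBall (0 : Fin D → ℝ) ρ ×ˢ Set.Icc 0 T)
      (Function.uncurry F.a) :=
    ((F.smooth.of_le (by simp)).locallyLipschitz).locallyLipschitzOn
  obtain ⟨L, hL⟩ := hl.exists_lipschitzOnWith_of_compact
    ((isCompact_closedBall 0 ρ).prod isCompact_Icc)
  refine ⟨L, fun t ht x hx y hy => ?_⟩
  simpa [Prod.edist_eq] using hL (Set.mk_mem_prod hx ht) (Set.mk_mem_prod hy ht)

theorem mem_closure_unitCube {x : Fin D → ℝ} (hx : ∀ i, x i ∈ Set.Icc (0 : ℝ) 1) :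
    x ∈ closure (unitCube D) := by
  have : unitCube D = Set.univ.pi fun _ => Set.Ioo (0 : ℝ) 1 := by
    ext; simp [unitCube]
  rw [this, closure_pi_set]
  intro i _
  rw [closure_Ioo zero_ne_one]
  exact hx i

theorem FlowData.forward_mem_Ico (F : FlowData D T) {t : ℝ} (ht : t ∈ Set.Icc 0 T)
    {x : Fin D → ℝ} (hx : ∀ i, x i ∈ Set.Ico (0 : ℝ) 1) (i : Fin D) :
    F.X 0 t x i ∈ Set.Ico (0 : ℝ) 1 :=
  trajectory_mem_Ico (V := fun s x => F.a x s) (γ := fun s => F.X 0 s x) ht.1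
    (fun s => F.flow_ode 0 x s)
    (fun ρ => (F.exists_lipschitzOnWith ρ).imp fun _ h s hs => h s ⟨hs.1, hs.2.trans ht.2⟩)
    (fun s hs y hy i hi => F.tangent s ⟨hs.1, hs.2.trans ht.2⟩ y (mem_closure_unitCube hy) i hi)
    (by rwa [F.flow_init]) i

theorem FlowData.hasDerivAt_reverse (F : FlowData D T) (τ t s : ℝ) (x : Fin D → ℝ) :
    HasDerivAt (fun s => F.X τ (t - s) x) (-F.a (F.X τ (t - s) x) (t - s)) s := by
  have := (F.flow_ode τ x (t - s)).scomp s ((hasDerivAt_id s).const_sub t)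
  simp only [neg_smul, one_smul] at this
  exact this

theorem FlowData.backward_mem_Ico (F : FlowData D T) {t : ℝ} (ht : t ∈ Set.Icc 0 T)
    {x : Fin D → ℝ} (hx : ∀ i, x i ∈ Set.Ico (0 : ℝ) 1) (i : Fin D) :
    F.X t 0 x i ∈ Set.Ico (0 : ℝ) 1 := by
  have hmem : ∀ s ∈ Set.Icc 0 t, t - s ∈ Set.Icc 0 T := fun s hs =>
    ⟨by linarith [hs.2], by linarith [hs.1, ht.2]⟩
  have := trajectory_mem_Ico (V := fun s x => -F.a x (t - s)) (γ := fun s => F.X t (t - s) x) ht.1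
    (fun s => F.hasDerivAt_reverse t t s x)
    (fun ρ => (F.exists_lipschitzOnWith ρ).imp fun _ h s hs => (h _ (hmem s hs)).neg)
    (fun s hs y hy i hi => by
      simpa using F.tangent _ (hmem s hs) y (mem_closure_unitCube hy) i hi)
    (by simpa [F.flow_init] using hx) i
  simpa using this

/-- The flow maps are uniformly bi-Lipschitz on the half-open unit cube. -/
theorem FlowData.exists_biLipschitz (F : FlowData D T) :
    ∃ L : ℝ, 1 ≤ L ∧ ∀ t ∈ Set.Icc 0 T, ∀ x y : Fin D → ℝ, (∀ i, x i ∈ Set.Ico (0 : ℝ) 1) →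
      (∀ i, y i ∈ Set.Ico (0 : ℝ) 1) →
      dist (F.X 0 t x) (F.X 0 t y) ≤ L * dist x y ∧
        dist x y ≤ L * dist (F.X 0 t x) (F.X 0 t y) := by
  obtain ⟨C, hC⟩ := F.exists_lipschitzOnWith 1
  have hball : ∀ s ∈ Set.Icc 0 T, ∀ x : Fin D → ℝ, (∀ i, x i ∈ Set.Ico (0 : ℝ) 1) →
      F.X 0 s x ∈ Metric.closedBall 0 1 := by
    intro s hs x hx
    rw [mem_closedBall_zero_iff, pi_norm_le_iff_of_nonneg zero_le_one]
    intro i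
    have := F.forward_mem_Ico hs hx i
    rw [Real.norm_eq_abs, abs_of_nonneg this.1]
    exact this.2.le
  have hTexp : ∀ t ∈ Set.Icc 0 T, Real.exp (C * t) ≤ Real.exp (C * |T|) := fun t ht =>
    Real.exp_le_exp.2 (by have := ht.2.trans (le_abs_self T); gcongr)
  refine ⟨Real.exp (C * |T|), Real.one_le_exp (by positivity), fun t ht x y hx hy => ⟨?_, ?_⟩⟩
  · have h := dist_le_of_trajectories_ODE_of_mem (v := fun s x => F.a x s) (a := 0) (b := t)
      (K := C) (δ := dist x y) (s := fun _ => Metric.closedBall 0 1)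
      (f := fun s => F.X 0 s x) (g := fun s => F.X 0 s y)
      (fun s hs => hC s ⟨hs.1, hs.2.le.trans ht.2⟩)
      (fun s _ => (F.flow_ode 0 x s).continuousAt.continuousWithinAt)
      (fun s _ => (F.flow_ode 0 x s).hasDerivWithinAt)
      (fun s hs => hball s ⟨hs.1, hs.2.le.trans ht.2⟩ x hx)
      (fun s _ => (F.flow_ode 0 y s).continuousAt.continuousWithinAt)
      (fun s _ => (F.flow_ode 0 y s).hasDerivWithinAt)
      (fun s hs => hball s ⟨hs.1, hs.2.le.trans ht.2⟩ y hy)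
      (by simp [F.flow_init]) t ⟨ht.1, le_rfl⟩
    rw [sub_zero] at h
    exact h.trans ((mul_le_mul_of_nonneg_left (hTexp t ht) dist_nonneg).trans_eq (mul_comm _ _))
  · have hmem : ∀ s ∈ Set.Ico 0 t, t - s ∈ Set.Icc 0 T := fun s hs =>
      ⟨by linarith [hs.2], by linarith [hs.1, ht.2]⟩
    have h := dist_le_of_trajectories_ODE_of_mem (v := fun s x => -F.a x (t - s)) (a := 0) (b := t)
      (K := C) (δ := dist (F.X 0 t x) (F.X 0 t y)) (s := fun _ => Metric.closedBall 0 1)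
      (f := fun s => F.X 0 (t - s) x) (g := fun s => F.X 0 (t - s) y)
      (fun s hs => (hC _ (hmem s hs)).neg)
      (fun s _ => (F.hasDerivAt_reverse 0 t s x).continuousAt.continuousWithinAt)
      (fun s _ => (F.hasDerivAt_reverse 0 t s x).hasDerivWithinAt)
      (fun s hs => hball _ (hmem s hs) x hx)
      (fun s _ => (F.hasDerivAt_reverse 0 t s y).continuousAt.continuousWithinAt)
      (fun s _ => (F.hasDerivAt_reverse 0 t s y).hasDerivWithinAt)
      (fun s hs => hball _ (hmem s hs) y hy)
      (by simp) t ⟨ht.1, le_rfl⟩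
    rw [sub_zero, sub_self, F.flow_init, F.flow_init] at h
    exact h.trans ((mul_le_mul_of_nonneg_left (hTexp t ht) dist_nonneg).trans_eq (mul_comm _ _))

end Flow

section Cells

variable {D M : ℕ}

theorem exists_mem_cell (hM : 0 < M) {x : Fin D → ℝ} (hx : ∀ i, x i ∈ Set.Ico (0 : ℝ) 1) :
    ∃ l, x ∈ cell D M l := by
  have hM' : (0 : ℝ) < M := Nat.cast_pos.2 hM
  have hn : ∀ i, 0 ≤ M * x i := fun i => mul_nonneg hM'.le (hx i).1
  refine ⟨fun i => ⟨⌊M * x i⌋₊, (Nat.floor_lt (hn i)).2 ?_⟩, (mem_cell_iff hM _ _).2 fun i => ?_⟩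
  · have := mul_lt_mul_of_pos_left (hx i).2 hM'
    rwa [mul_one] at this
  · rw [localCoord]
    exact ⟨sub_nonneg.2 (Nat.floor_le (hn i)), by linarith [Nat.lt_floor_add_one (M * x i)]⟩

theorem eq_of_mem_cell (hM : 0 < M) {l l' : Fin D → Fin M} {x : Fin D → ℝ} (h : x ∈ cell D M l)
    (h' : x ∈ cell D M l') : l = l' := by
  funext i
  have h1 := (mem_cell_iff hM l x).1 h i
  have h2 := (mem_cell_iff hM l' x).1 h' i
  rw [localCoord] at h1 h2
  have h3 : ((l i : ℕ) : ℝ) < ((l' i : ℕ) : ℝ) + 1 := by linarith [h1.1, h2.2]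
  have h4 : ((l' i : ℕ) : ℝ) < ((l i : ℕ) : ℝ) + 1 := by linarith [h2.1, h1.2]
  norm_cast at h3 h4
  ext
  omega

theorem mem_Ico_of_mem_cell (hM : 0 < M) {l : Fin D → Fin M} {x : Fin D → ℝ}
    (h : x ∈ cell D M l) (i : Fin D) : x i ∈ Set.Ico (0 : ℝ) 1 := by
  have hM' : (0 : ℝ) < M := Nat.cast_pos.2 hM
  have h1 := (mem_cell_iff hM l x).1 h i
  rw [localCoord] at h1
  have h2 : ((l i : ℕ) : ℝ) + 1 ≤ M := by exact_mod_cast (l i).2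
  have h3 : (0 : ℝ) ≤ (l i : ℕ) := Nat.cast_nonneg _
  constructor
  · by_contra! hneg
    nlinarith [h1.1]
  · by_contra! hge
    nlinarith [h1.2]

theorem dist_localCoord (l : Fin D → Fin M) (x y : Fin D → ℝ) :
    dist (localCoord l x) (localCoord l y) = M * dist x y := by
  have : localCoord l x - localCoord l y = (M : ℝ) • (x - y) := by
    funext i
    simp only [localCoord, Pi.sub_apply, Pi.smul_apply, smul_eq_mul]
    ring
  rw [dist_eq_norm, dist_eq_norm, this, norm_smul, Real.norm_natCast]

theorem exists_localCoord_eq (hM : 0 < M) (l : Fin D → Fin M) (z : Fin D → ℝ) :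
    ∃ y, localCoord l y = z := by
  have hM' : (M : ℝ) ≠ 0 := Nat.cast_ne_zero.2 hM.ne'
  refine ⟨fun i => ((l i : ℕ) + z i) / M, ?_⟩
  funext i
  rw [localCoord]
  field_simp
  ring

theorem dist_le_of_mem_cell (hM : 0 < M) {l : Fin D → Fin M} {x y : Fin D → ℝ}
    (hx : x ∈ cell D M l) (hy : y ∈ cell D M l) : dist x y ≤ 1 / M := by
  have hM' : (0 : ℝ) < M := Nat.cast_pos.2 hM
  rw [le_div_iff₀ hM', mul_comm, ← dist_localCoord l, dist_pi_le_iff zero_le_one]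
  intro i
  have h1 := (mem_cell_iff hM l x).1 hx i
  have h2 := (mem_cell_iff hM l y).1 hy i
  rw [Real.dist_eq, abs_le]
  constructor <;> linarith [h1.1, h1.2, h2.1, h2.2]

end Cells

section Counting

variable {D K : ℕ}

/-- A ball of radius `R ≥ 1/K` contains at least a fixed multiple of `(R K)^D` of the points of a
`K`-grid sample. -/
theorem le_card_dist_lt (hK : 0 < K) {x0 : (Fin D → Fin K) → Fin D → ℝ}
    (hx0 : ∀ k, x0 k ∈ cell D K k) {Y : Fin D → ℝ} (hY : ∀ i, Y i ∈ Set.Ico (0 : ℝ) 1) {R : ℝ}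
    (hR : 1 ≤ R * K) (hR1 : R ≤ 1) :
    (R * K / 2) ^ D ≤ ((Finset.univ.filter fun k => dist (x0 k) Y < R).card : ℝ) := by
  have hK' : (0 : ℝ) < K := Nat.cast_pos.2 hK
  have hR0 : 0 < R := pos_of_mul_pos_left (zero_lt_one.trans_le hR) hK'.le
  obtain ⟨m, hm⟩ := exists_mem_cell hK hY
  set Q := ⌊R * K⌋₊ with hQ
  have hQ1 : 1 ≤ Q := Nat.one_le_floor_iff _ |>.2 hR
  have hQle : (Q : ℝ) ≤ R * K := Nat.floor_le (by positivity)
  have hQK : Q ≤ K := by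
    have : (Q : ℝ) ≤ K := hQle.trans (by nlinarith)
    exact_mod_cast this
  have hQge : R * K / 2 ≤ Q := by
    have h1 := Nat.lt_floor_add_one (R * K)
    have h2 : (1 : ℝ) ≤ Q := by exact_mod_cast hQ1
    linarith
  set I : Fin D → Finset (Fin K) := fun i =>
    Finset.Icc ⟨(m i : ℕ) - (Q - 1), by omega⟩ ⟨min ((m i : ℕ) + (Q - 1)) (K - 1), by omega⟩ with hI
  have hcard : ∀ i, Q ≤ (I i).card := by
    intro i
    have := (m i).2
    simp only [hI, Fin.card_Icc]
    omega
  have hsub : Fintype.piFinset I ⊆ Finset.univ.filter fun k => dist (x0 k) Y < R := by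
    intro k hk
    rw [Finset.mem_filter, dist_pi_lt_iff hR0]
    refine ⟨Finset.mem_univ _, fun i => ?_⟩
    have hki := Finset.mem_Icc.1 (Fintype.mem_piFinset.1 hk i)
    have h1 : (m i : ℕ) + 1 ≤ k i + Q := by
      have : (m i : ℕ) - (Q - 1) ≤ k i := hki.1
      omega
    have h2 : (k i : ℕ) + 1 ≤ m i + Q := by
      have : (k i : ℕ) ≤ min ((m i : ℕ) + (Q - 1)) (K - 1) := hki.2
      omega
    have h1' : ((m i : ℕ) : ℝ) + 1 ≤ (k i : ℕ) + Q := by exact_mod_cast h1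
    have h2' : ((k i : ℕ) : ℝ) + 1 ≤ (m i : ℕ) + Q := by exact_mod_cast h2
    have h3 := (mem_cell_iff hK k (x0 k)).1 (hx0 k) i
    have h4 := (mem_cell_iff hK m Y).1 hm i
    rw [localCoord] at h3 h4
    rw [Real.dist_eq, abs_lt]
    constructor
    · refine lt_of_mul_lt_mul_left ?_ hK'.le
      nlinarith [h3.1, h3.2, h4.1, h4.2]
    · refine lt_of_mul_lt_mul_left ?_ hK'.le
      nlinarith [h3.1, h3.2, h4.1, h4.2]
  calc (R * K / 2) ^ D ≤ (Q : ℝ) ^ D := by gcongr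
    _ = ((∏ _i : Fin D, Q : ℕ) : ℝ) := by simp
    _ ≤ ((∏ i, (I i).card : ℕ) : ℝ) := by
      exact_mod_cast Finset.prod_le_prod' fun i _ => hcard i
    _ ≤ _ := by
      rw [← Fintype.card_piFinset]
      exact_mod_cast Finset.card_le_card hsub

/-- A set of diameter at most `R`, where `R ≥ 1/K`, contains at most a fixed multiple of
`(R K)^D` of the points of a `K`-grid sample. -/
theorem card_le_of_dist_le (hK : 0 < K) {x0 : (Fin D → Fin K) → Fin D → ℝ}
    (hx0 : ∀ k, x0 k ∈ cell D K k) {R : ℝ} (hR : 1 ≤ R * K) {S : Finset (Fin D → Fin K)}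
    (hS : ∀ k ∈ S, ∀ k' ∈ S, dist (x0 k) (x0 k') ≤ R) : (S.card : ℝ) ≤ (5 * (R * K)) ^ D := by
  have hK' : (0 : ℝ) < K := Nat.cast_pos.2 hK
  rcases S.eq_empty_or_nonempty with rfl | ⟨m, hm⟩
  · simp only [Finset.card_empty, Nat.cast_zero]
    positivity
  set Q := ⌊R * K + 1⌋₊ with hQ
  have hQle : (Q : ℝ) ≤ R * K + 1 := Nat.floor_le (by positivity)
  set I : Fin D → Finset (Fin K) := fun i =>
    Finset.univ.filter fun a => (m i : ℕ) ≤ a + Q ∧ (a : ℕ) ≤ m i + Q with hI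
  have hcard : ∀ i, (I i).card ≤ 2 * Q + 1 := by
    intro i
    have h := Finset.card_le_card_of_injOn (s := I i) (t := Finset.Icc ((m i : ℕ) - Q) (m i + Q))
      (fun a => (a : ℕ)) (fun a ha => by
        have := (Finset.mem_filter.1 ha).2
        simp only [Finset.coe_Icc, Set.mem_Icc]
        omega) (Fin.val_injective.injOn)
    rw [Nat.card_Icc] at h
    omega
  have hsub : S ⊆ Fintype.piFinset I := by
    intro k hk
    refine Fintype.mem_piFinset.2 fun i => Finset.mem_filter.2 ⟨Finset.mem_univ _, ?_⟩
    have hd := (dist_le_pi_dist (x0 k) (x0 m) i).trans (hS k hk m hm)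
    rw [Real.dist_eq, abs_le] at hd
    have h3 := (mem_cell_iff hK k (x0 k)).1 (hx0 k) i
    have h4 := (mem_cell_iff hK m (x0 m)).1 (hx0 m) i
    rw [localCoord] at h3 h4
    have hlt := Nat.lt_floor_add_one (R * K + 1)
    have h5 : ((m i : ℕ) : ℝ) < (k i : ℕ) + Q + 1 := by nlinarith [hd.1, h3.1, h3.2, h4.1, h4.2]
    have h6 : ((k i : ℕ) : ℝ) < (m i : ℕ) + Q + 1 := by nlinarith [hd.2, h3.1, h3.2, h4.1, h4.2]
    norm_cast at h5 h6
    omega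
  calc (S.card : ℝ) ≤ ((∏ i, (I i).card : ℕ) : ℝ) := by
        rw [← Fintype.card_piFinset]
        exact_mod_cast Finset.card_le_card hsub
    _ ≤ ((∏ _i : Fin D, (2 * Q + 1) : ℕ) : ℝ) := by
      exact_mod_cast Finset.prod_le_prod' fun i _ => hcard i
    _ = (2 * Q + 1 : ℝ) ^ D := by simp
    _ ≤ (5 * (R * K)) ^ D := by
      gcongr
      linarith

/-- Two-sided bounds for the number of particles in a cell of the coarse grid, and for the number
of those in a fixed ball inside the cell. -/
theorem FlowData.exists_card_bounds {T : ℝ} (F : FlowData D T) {r : ℝ} (hr : 0 < r) (hr1 : r < 1) :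
    ∃ d₀ c C : ℝ, d₀ ∈ Set.Ioo (0 : ℝ) 1 ∧ 0 < c ∧ 0 < C ∧
      ∀ M K : ℕ, 0 < M → 0 < K → (M : ℝ) ≤ d₀ * (K : ℝ) →
      ∀ x0 : (Fin D → Fin K) → (Fin D → ℝ), (∀ k, x0 k ∈ cell D K k) →
      ∀ t ∈ Set.Icc (0 : ℝ) T, ∀ l : Fin D → Fin M,
        (∀ z ∈ unitCube D, ∀ S : Finset (Fin D → Fin K),
          (∀ k, localCoord l (F.X 0 t (x0 k)) ∈ Metric.ball z r → k ∈ S) →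
          c * (K / M : ℝ) ^ D ≤ S.card) ∧
        ∀ S : Finset (Fin D → Fin K), (∀ k ∈ S, F.X 0 t (x0 k) ∈ cell D M l) →
          S.card ≤ C * (K / M : ℝ) ^ D := by
  obtain ⟨L, hL1, hL⟩ := F.exists_biLipschitz
  have hL0 : 0 < L := zero_lt_one.trans_le hL1
  refine ⟨r / L, (r / L / 2) ^ D, (5 * L) ^ D, ⟨by positivity, ?_⟩, by positivity, by positivity,
    fun M K hM hK hMK x0 hx0 t ht l => ⟨fun z hz S hS => ?_, fun S hS => ?_⟩⟩
  · rw [div_lt_one hL0]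
    linarith
  · have hM' : (0 : ℝ) < M := Nat.cast_pos.2 hM
    have hx0' := fun k => mem_Ico_of_mem_cell hK (hx0 k)
    obtain ⟨y, hly⟩ := exists_localCoord_eq hM l z
    have hyI : ∀ i, y i ∈ Set.Ico (0 : ℝ) 1 := by
      refine mem_Ico_of_mem_cell hM ((mem_cell_iff hM l y).2 fun i => ?_)
      rw [hly]
      exact ⟨(hz i).1.le, (hz i).2⟩
    have hYI := F.backward_mem_Ico ht hyI
    have hYy : F.X 0 t (F.X t 0 y) = y := F.flow_inv t 0 y
    have hRK : r / L / M * K = r / L * (K / M) := by ring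
    have h := le_card_dist_lt hK hx0 hYI (R := r / L / M) ?_ ?_
    · calc (r / L / 2) ^ D * (K / M : ℝ) ^ D = (r / L / M * K / 2) ^ D := by
            rw [← mul_pow]
            ring
        _ ≤ _ := h
        _ ≤ _ := by
          refine Nat.cast_le.2 (Finset.card_le_card fun k hk => hS k ?_)
          have hd := (Finset.mem_filter.1 hk).2
          have hd' := (hL t ht _ _ (hx0' k) hYI).1
          rw [hYy] at hd'
          rw [Metric.mem_ball, ← hly, dist_localCoord]
          calc M * dist (F.X 0 t (x0 k)) y ≤ M * (L * dist (x0 k) (F.X t 0 y)) := by gcongr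
            _ < M * (L * (r / L / M)) := by gcongr
            _ = r := by field_simp
    · rw [hRK, ← mul_div_assoc, one_le_div hM']
      exact hMK
    · have h1 : (1 : ℝ) ≤ M := by exact_mod_cast hM
      rw [div_div, div_le_one (by positivity)]
      nlinarith
  · have hM' : (0 : ℝ) < M := Nat.cast_pos.2 hM
    have hx0' := fun k => mem_Ico_of_mem_cell hK (hx0 k)
    have h := card_le_of_dist_le hK hx0 (R := L / M) ?_ (S := S) ?_
    · calc (S.card : ℝ) ≤ _ := h
        _ = (5 * L) ^ D * (K / M : ℝ) ^ D := by
          rw [← mul_pow]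
          ring
    · rw [div_mul_eq_mul_div, one_le_div hM']
      have h1 : r / L ≤ L := (div_le_one hL0 |>.2 (by linarith)).trans hL1
      exact hMK.trans (by gcongr)
    · intro k hk k' hk'
      refine (hL t ht _ _ (hx0' k) (hx0' k')).2.trans ?_
      rw [← mul_one_div]
      gcongr
      exact dist_le_of_mem_cell hM (hS k hk) (hS k' hk')

end Counting

section CellIntegrals

variable {D M : ℕ}

theorem cell_eq_pi (l : Fin D → Fin M) :
    cell D M l = Set.univ.pi fun i => Set.Ico (((l i : ℕ) : ℝ) / M) ((((l i : ℕ) : ℝ) + 1) / M) := by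
  ext
  simp [cell]

theorem measurableSet_cell (l : Fin D → Fin M) : MeasurableSet (cell D M l) := by
  rw [cell_eq_pi]
  exact MeasurableSet.univ_pi fun _ => measurableSet_Ico

theorem volume_real_cell (l : Fin D → Fin M) : volume.real (cell D M l) = (1 / M : ℝ) ^ D := by
  rw [cell_eq_pi, Measure.real, Real.volume_pi_Ico_toReal]
  · simp [← sub_div]
  · intro i
    dsimp only
    gcongr
    simp

theorem continuous_localCoord (l : Fin D → Fin M) : Continuous (localCoord l) := by
  unfold localCoord
  fun_prop

theorem integrableOn_cell {g : (Fin D → ℝ) → ℝ} (hg : Continuous g) (l : Fin D → Fin M) :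
    IntegrableOn g (cell D M l) := by
  refine (hg.integrableOn_Icc (a := fun i => ((l i : ℕ) : ℝ) / M)
    (b := fun i => (((l i : ℕ) : ℝ) + 1) / M)).mono_set fun x hx => ?_
  exact ⟨fun i => (hx i).1, fun i => (hx i).2.le⟩

/-- Removing some grid cells from the unit cube leaves the remaining ones, up to a null set. -/
theorem unitCube_diff_ae_eq (hM : 0 < M) (P : (Fin D → Fin M) → Prop) [DecidablePred P] :
    (unitCube D \ ⋃ (l) (_ : P l), cell D M l : Set (Fin D → ℝ)) =ᵐ[volume]
      ⋃ l ∈ Finset.univ.filter fun l => ¬ P l, cell D M l := by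
  have h1 : unitCube D = Set.univ.pi fun _ => Set.Ioo (0 : ℝ) 1 := by
    ext
    simp [unitCube]
  have h2 : unitCube D =ᵐ[volume] Set.univ.pi fun _ => Set.Ico (0 : ℝ) 1 := by
    rw [h1]
    exact (Measure.univ_pi_Ioo_ae_eq_Icc (f := fun _ => (0 : ℝ)) (g := fun _ => (1 : ℝ))).trans
      (Measure.univ_pi_Ico_ae_eq_Icc (f := fun _ => (0 : ℝ)) (g := fun _ => (1 : ℝ))).symm
  suffices h3 : ((Set.univ.pi fun _ => Set.Ico (0 : ℝ) 1) \ ⋃ (l) (_ : P l), cell D M l :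
      Set (Fin D → ℝ)) = ⋃ l ∈ Finset.univ.filter fun l => ¬ P l, cell D M l by
    rw [← h3]
    exact h2.diff (ae_eq_refl _)
  ext x
  simp only [Set.mem_sdiff, Set.mem_univ_pi, Set.mem_iUnion, Finset.mem_filter, Finset.mem_univ,
    true_and, not_exists, exists_prop]
  constructor
  · rintro ⟨hx, hn⟩
    obtain ⟨l, hl⟩ := exists_mem_cell hM hx
    exact ⟨l, fun hP => hn l ⟨hP, hl⟩, hl⟩
  · rintro ⟨l, hP, hl⟩
    refine ⟨mem_Ico_of_mem_cell hM hl, fun l' ⟨hP', hl'⟩ => hP ?_⟩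
    rwa [eq_of_mem_cell hM hl hl']

theorem setIntegral_unitCube_diff (hM : 0 < M) (P : (Fin D → Fin M) → Prop) [DecidablePred P]
    {g : (Fin D → ℝ) → ℝ} (hg : ∀ l, IntegrableOn g (cell D M l)) :
    ∫ x in unitCube D \ ⋃ (l) (_ : P l), cell D M l, g x =
      ∑ l, if P l then 0 else ∫ x in cell D M l, g x := by
  rw [setIntegral_congr_set (unitCube_diff_ae_eq hM P),
    integral_biUnion_finset _ (fun l _ => measurableSet_cell l) _ (fun l _ => hg l),
    Finset.sum_filter]
  · exact Finset.sum_congr rfl fun l _ => by split_ifs <;> rfl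
  · intro l _ l' _ hne
    exact Set.disjoint_left.2 fun x hx hx' => hne (eq_of_mem_cell hM hx hx')

theorem localCoord_mem_Icc (hM : 0 < M) {l : Fin D → Fin M} {x : Fin D → ℝ}
    (hx : x ∈ cell D M l) : localCoord l x ∈ Set.Icc (0 : Fin D → ℝ) 1 :=
  ⟨fun i => ((mem_cell_iff hM l x).1 hx i).1, fun i => ((mem_cell_iff hM l x).1 hx i).2.le⟩

variable {m : ℕ} {c : (Fin D → Fin (m + 1)) → ℝ}

theorem integral_cell_sq_le (hM : 0 < M) (l : Fin D → Fin M) {b : ℝ}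
    (hb : ∀ y ∈ Set.Icc (0 : Fin D → ℝ) 1, |tensorEval c y| ≤ b) :
    ∫ x in cell D M l, tensorEval c (localCoord l x) ^ 2 ≤ b ^ 2 * (1 / M : ℝ) ^ D := by
  have hcont : Continuous fun x => tensorEval c (localCoord l x) ^ 2 :=
    ((continuous_tensorEval c).comp (continuous_localCoord l)).pow 2
  calc ∫ x in cell D M l, tensorEval c (localCoord l x) ^ 2 ≤ ∫ _x in cell D M l, b ^ 2 := by
        refine setIntegral_mono_on (integrableOn_cell hcont l) (integrableOn_cell continuous_const l)
          (measurableSet_cell l) fun x hx => ?_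
        rw [← sq_abs]
        have := hb _ (localCoord_mem_Icc hM hx)
        gcongr
    _ = b ^ 2 * (1 / M : ℝ) ^ D := by
      rw [setIntegral_const, volume_real_cell, smul_eq_mul, mul_comm]

theorem le_integral_cell_sq (hM : 0 < M) (l : Fin D → Fin M) {z : Fin D → ℝ} {r b : ℝ}
    (hr : 0 < r) (hz : Metric.ball z r ⊆ unitCube D) (hb0 : 0 ≤ b)
    (hb : ∀ y ∈ Metric.ball z r, b ≤ |tensorEval c y|) :
    b ^ 2 * (2 * r / M) ^ D ≤ ∫ x in cell D M l, tensorEval c (localCoord l x) ^ 2 := by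
  have hM' : (0 : ℝ) < M := Nat.cast_pos.2 hM
  have hcont : Continuous fun x => tensorEval c (localCoord l x) ^ 2 :=
    ((continuous_tensorEval c).comp (continuous_localCoord l)).pow 2
  obtain ⟨y, hly⟩ := exists_localCoord_eq hM l z
  have hball : ∀ x ∈ Metric.ball y (r / M), localCoord l x ∈ Metric.ball z r := by
    intro x hx
    rw [Metric.mem_ball, lt_div_iff₀ hM', mul_comm] at hx
    rwa [Metric.mem_ball, ← hly, dist_localCoord]
  have hsub : Metric.ball y (r / M) ⊆ cell D M l := fun x hx =>
    (mem_cell_iff hM l x).2 fun i => Set.Ioo_subset_Ico_self (hz (hball x hx) i)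
  have hvol : volume.real (Metric.ball y (r / M)) = (2 * r / M) ^ D := by
    rw [Measure.real, Real.volume_pi_ball _ (by positivity), Fintype.card_fin,
      ENNReal.toReal_ofReal (by positivity), mul_div_assoc]
  calc b ^ 2 * (2 * r / M) ^ D = ∫ _x in Metric.ball y (r / M), b ^ 2 := by
        rw [setIntegral_const, hvol, smul_eq_mul, mul_comm]
    _ ≤ ∫ x in Metric.ball y (r / M), tensorEval c (localCoord l x) ^ 2 := by
      refine setIntegral_mono_on ((integrableOn_cell continuous_const l).mono_set hsub)
        ((integrableOn_cell hcont l).mono_set hsub) measurableSet_ball fun x hx => ?_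
      rw [← sq_abs (tensorEval _ _)]
      have := hb _ (hball x hx)
      gcongr
    _ ≤ _ := setIntegral_mono_set (integrableOn_cell hcont l)
      (Filter.Eventually.of_forall fun x => sq_nonneg _) hsub.eventuallyLE

end CellIntegrals

section Decay

variable {D M : ℕ}

/-- The cell with index `l` belongs to the discrete neighbourhood `D_{j,k}`. -/
def CellNear (j : Fin D → Fin M) (k : ℕ) (l : Fin D → Fin M) : Prop :=
  ∀ i, (l i : ℕ) < j i + k ∧ (j i : ℕ) < l i + k

theorem CellNear.mono {j l : Fin D → Fin M} {k k' : ℕ} (h : CellNear j k l) (hk : k ≤ k') :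
    CellNear j k' l := fun i => by
  have := h i
  omega

theorem cellNbhd_eq_iUnion (hM : 0 < M) (j : Fin D → Fin M) (k : ℕ) :
    cellNbhd D M j k = ⋃ (l) (_ : CellNear j k l), cell D M l := by
  have hM' : (0 : ℝ) < M := Nat.cast_pos.2 hM
  refine Set.iUnion_congr fun l => Set.iUnion_congr_Prop (forall_congr' fun i => ?_) fun _ => rfl
  rw [← sub_div, abs_div, abs_of_pos hM', div_lt_div_iff_of_pos_right hM', add_sub_add_right_eq_sub,
    abs_lt, neg_lt_sub_iff_lt_add, sub_lt_iff_lt_add', and_comm,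
    add_comm (k : ℝ)]
  norm_cast

/-- Truncation of the B-spline coefficients: a spline can be modified to vanish near a given cell
while being unchanged away from it, without enlarging its local coefficients. -/
theorem IsSpline.exists_cutoff {p : ℕ} {u : (Fin D → ℝ) → ℝ} (hM : 0 < M)
    (hu : IsSpline D M (p + 2) u) {c : (Fin D → Fin M) → (Fin D → Fin (p + 1 + 1)) → ℝ}
    (hc : ∀ l, ∀ x ∈ cell D M l, u x = tensorEval (c l) (localCoord l x))
    (j : Fin D → Fin M) (k : ℕ) :
    ∃ (v : (Fin D → ℝ) → ℝ) (c' : (Fin D → Fin M) → (Fin D → Fin (p + 1 + 1)) → ℝ),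
      IsSpline D M (p + 2) v ∧
      (∀ l, ∀ x ∈ cell D M l, v x = tensorEval (c' l) (localCoord l x)) ∧
      (∀ l, ‖c' l‖ ≤ ‖c l‖) ∧ (∀ l, CellNear j (k + 1) l → c' l = 0) ∧
      ∀ l, ¬ CellNear j (k + (p + 2)) l → c' l = c l := by
  classical
  obtain ⟨G, hG⟩ := hu.exists_global_coeff hM hc
  set keep : (Fin D → ℕ) → Prop := fun a => ∃ i, a i + k < j i ∨ j i + k + (p + 2) ≤ a i with hkeep
  refine ⟨bsplineSum D M (p + 1) fun a => if keep a then G a else 0,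
    fun l s => if keep (fun i => (l i : ℕ) + (s i : ℕ)) then c l s else 0,
    isSpline_bsplineSum hM _, fun l x hx => ?_, fun l => ?_, fun l hl => ?_, fun l hl => ?_⟩
  · rw [bsplineSum_cell hM (by omega) _ l hx]
    simp only [hG]
  · rw [pi_norm_le_iff_of_nonneg (norm_nonneg _)]
    intro s
    dsimp only
    split_ifs
    · exact norm_le_pi_norm (c l) s
    · simp
  · funext s
    refine if_neg ?_
    rintro ⟨i, hi⟩
    have := hl i
    have := (s i).2
    dsimp only at hi
    omega
  · funext s
    refine if_pos ?_
    simp only [CellNear, not_forall] at hl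
    obtain ⟨i, hi⟩ := hl
    refine ⟨i, ?_⟩
    have := (s i).2
    dsimp only
    omega

open Classical in
/-- The mass of `u²` outside the discrete neighbourhood `D_{j,k}`, as a sum over cells. -/
def farMass (u : (Fin D → ℝ) → ℝ) (j : Fin D → Fin M) (k : ℕ) : ℝ :=
  ∑ l, if CellNear j k l then 0 else ∫ x in cell D M l, u x ^ 2

/-- The mass outside a neighbourhood decreases by a fixed factor when the radius of the
neighbourhood grows by the order of the splines. -/
theorem FlowData.exists_farMass_le {T : ℝ} (F : FlowData D T) (p : ℕ) :
    ∃ d₀ θ : ℝ, d₀ ∈ Set.Ioo (0 : ℝ) 1 ∧ θ ∈ Set.Ioo (0 : ℝ) 1 ∧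
      ∀ M K : ℕ, 0 < M → 0 < K → (M : ℝ) ≤ d₀ * (K : ℝ) →
      ∀ x0 : (Fin D → Fin K) → (Fin D → ℝ), (∀ k, x0 k ∈ cell D K k) →
      ∀ t ∈ Set.Icc (0 : ℝ) T,
      ∀ j : Fin D → Fin M, ∀ f u : (Fin D → ℝ) → ℝ, IsSpline D M (p + 2) u →
        (∀ v : (Fin D → ℝ) → ℝ, IsSpline D M (p + 2) v →
          ∑ k : Fin D → Fin K,
              ((1 : ℝ) / K) ^ D * u (F.X 0 t (x0 k)) * v (F.X 0 t (x0 k)) =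
            ∫ x in cell D M j, f x * v x) →
      ∀ k : ℕ, farMass u j (k + (p + 2)) ≤ θ * farMass u j k := by
  classical
  obtain ⟨B, hB0, hB⟩ := exists_tensorEval_le D (p + 1)
  obtain ⟨r, η, hr0, hr1, hη0, hη⟩ := exists_le_tensorEval D (p + 1)
  obtain ⟨d₀, c₁, C₁, hd₀, hc₁, hC₁, hcount⟩ := F.exists_card_bounds hr0 hr1
  set α : ℝ := c₁ * η ^ 2 / B ^ 2 with hα
  set β : ℝ := C₁ * B ^ 2 / (η ^ 2 * (2 * r) ^ D) with hβ
  have hα0 : 0 < α := by positivity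
  have hβ0 : 0 < β := by positivity
  refine ⟨d₀, β / (α + β), hd₀, ⟨by positivity, by rw [div_lt_one (by positivity)]; linarith⟩,
    fun M K hM hK hMK x0 hx0 t ht j f u hu huv k => ?_⟩
  have hM' : (0 : ℝ) < M := Nat.cast_pos.2 hM
  have hK' : (0 : ℝ) < K := Nat.cast_pos.2 hK
  obtain ⟨c, hc⟩ := hu.exists_coeff hM
  obtain ⟨v, c', hv, hc', hnorm, hnear, hfar⟩ := hu.exists_cutoff hM hc j k
  have hzero : ∑ k : Fin D → Fin K,
      ((1 : ℝ) / K) ^ D * u (F.X 0 t (x0 k)) * v (F.X 0 t (x0 k)) = 0 := by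
    rw [huv v hv, setIntegral_congr_fun (g := fun _ => 0) (measurableSet_cell j) fun x hx => ?_,
      integral_zero]
    dsimp only
    rw [hc' j x hx, hnear j fun i => by omega]
    simp [tensorEval]
  choose q hq using fun k =>
    exists_mem_cell hM (F.forward_mem_Ico ht (mem_Ico_of_mem_cell hK (hx0 k)))
  rw [← Finset.sum_fiberwise Finset.univ q] at hzero
  set I : (Fin D → Fin M) → ℝ := fun l => ∫ x in cell D M l, u x ^ 2 with hI
  have hIeq : ∀ l, I l = ∫ x in cell D M l, tensorEval (c l) (localCoord l x) ^ 2 := fun l =>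
    setIntegral_congr_fun (measurableSet_cell l) fun x hx => by
      rw [hc l x hx]
  have hscale : ∀ b e : ℝ, (1 / K : ℝ) ^ D * (b * (K / M : ℝ) ^ D * e) = b * e * (1 / M : ℝ) ^ D := by
    intro b e
    rw [div_pow, div_pow, div_pow]
    field_simp
  have hfiber : ∀ l, (α + β) * (if CellNear j (k + (p + 2)) l then 0 else I l) -
      β * (if CellNear j k l then 0 else I l) ≤
      ∑ k with q k = l, ((1 : ℝ) / K) ^ D * u (F.X 0 t (x0 k)) * v (F.X 0 t (x0 k)) := by
    intro l
    have hmem : ∀ k ∈ Finset.univ.filter fun k => q k = l, F.X 0 t (x0 k) ∈ cell D M l := by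
      intro k hk
      rw [← (Finset.mem_filter.1 hk).2]
      exact hq k
    by_cases hl : CellNear j (k + (p + 2)) l
    · rw [if_pos hl]
      by_cases hl' : CellNear j k l
      · rw [if_pos hl']
        refine (le_of_eq ?_ : _ ≤ (0 : ℝ)).trans (Finset.sum_nonneg fun k hk => ?_)
        · ring
        · rw [hc' l _ (hmem k hk), hnear l (hl'.mono (by omega))]
          simp [tensorEval]
      · rw [if_neg hl']
        obtain ⟨z, hzsub, hz, hηz⟩ := hη (c l)
        have hIge := le_integral_cell_sq hM l hr0 hzsub (by positivity) hηz
        rw [← hIeq] at hIge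
        have hcard := (hcount M K hM hK hMK x0 hx0 t ht l).2 _ hmem
        have hterm : ∀ k ∈ Finset.univ.filter fun k => q k = l,
            -((1 / K : ℝ) ^ D * (B * ‖c l‖) ^ 2) ≤
              ((1 : ℝ) / K) ^ D * u (F.X 0 t (x0 k)) * v (F.X 0 t (x0 k)) := by
          intro k hk
          have hy := localCoord_mem_Icc hM (hmem k hk)
          have h1 := hB (c l) _ hy
          have h2 := (hB (c' l) _ hy).trans (mul_le_mul_of_nonneg_left (hnorm l) hB0.le)
          rw [hc l _ (hmem k hk), hc' l _ (hmem k hk), mul_assoc, ← mul_neg]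
          refine mul_le_mul_of_nonneg_left (neg_le_of_abs_le ?_) (by positivity)
          rw [abs_mul, sq]
          gcongr
        refine le_trans ?_ (Finset.card_nsmul_le_sum _ _ _ hterm)
        rw [nsmul_eq_mul, mul_zero, zero_sub, mul_neg, neg_le_neg_iff]
        calc ((Finset.univ.filter fun k => q k = l).card : ℝ) * ((1 / K : ℝ) ^ D * (B * ‖c l‖) ^ 2)
            = (1 / K : ℝ) ^ D * ((Finset.univ.filter fun k => q k = l).card * (B * ‖c l‖) ^ 2) := by
              ring
          _ ≤ (1 / K : ℝ) ^ D * (C₁ * (K / M : ℝ) ^ D * (B * ‖c l‖) ^ 2) := by gcongr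
          _ = C₁ * (B * ‖c l‖) ^ 2 * (1 / M : ℝ) ^ D := hscale _ _
          _ = β * ((η * ‖c l‖) ^ 2 * (2 * r / M) ^ D) := by
            rw [hβ, div_pow (2 * r), div_pow (1 : ℝ)]
            field_simp
            ring
          _ ≤ β * I l := by gcongr
    · have hl' : ¬ CellNear j k l := fun h => hl (h.mono (by omega))
      rw [if_neg hl, if_neg hl']
      obtain ⟨z, hzsub, hz, hηz⟩ := hη (c l)
      have hIle := integral_cell_sq_le hM l (hB (c l))
      rw [← hIeq] at hIle
      have hpos : ∀ k ∈ Finset.univ.filter fun k => q k = l,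
          ((1 : ℝ) / K) ^ D * u (F.X 0 t (x0 k)) * v (F.X 0 t (x0 k)) =
            (1 / K : ℝ) ^ D * tensorEval (c l) (localCoord l (F.X 0 t (x0 k))) ^ 2 := by
        intro k hk
        rw [hc l _ (hmem k hk), hc' l _ (hmem k hk), hfar l hl, sq, mul_assoc]
      rw [Finset.sum_congr rfl hpos]
      set S := Finset.univ.filter fun k => localCoord l (F.X 0 t (x0 k)) ∈ Metric.ball z r with hS
      have hSsub : S ⊆ Finset.univ.filter fun k => q k = l := by
        intro k hk
        refine Finset.mem_filter.2 ⟨Finset.mem_univ _, eq_of_mem_cell hM (hq k) ?_⟩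
        exact (mem_cell_iff hM l _).2 fun i =>
          Set.Ioo_subset_Ico_self (hzsub (Finset.mem_filter.1 hk).2 i)
      have hcard := (hcount M K hM hK hMK x0 hx0 t ht l).1 z hz S fun k hk =>
        Finset.mem_filter.2 ⟨Finset.mem_univ _, hk⟩
      refine le_trans ?_ (Finset.sum_le_sum_of_subset_of_nonneg hSsub fun k _ _ => by positivity)
      have hterm : ∀ k ∈ S, (1 / K : ℝ) ^ D * (η * ‖c l‖) ^ 2 ≤
          (1 / K : ℝ) ^ D * tensorEval (c l) (localCoord l (F.X 0 t (x0 k))) ^ 2 := by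
        intro k hk
        rw [← sq_abs (tensorEval _ _)]
        have := hηz _ (Finset.mem_filter.1 hk).2
        gcongr
      refine le_trans ?_ (Finset.card_nsmul_le_sum _ _ _ hterm)
      rw [nsmul_eq_mul]
      calc (α + β) * I l - β * I l = α * I l := by ring
        _ ≤ α * ((B * ‖c l‖) ^ 2 * (1 / M : ℝ) ^ D) := by gcongr
        _ = c₁ * (η * ‖c l‖) ^ 2 * (1 / M : ℝ) ^ D := by
          rw [hα]
          field_simp
        _ = (1 / K : ℝ) ^ D * (c₁ * (K / M : ℝ) ^ D * (η * ‖c l‖) ^ 2) := (hscale _ _).symm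
        _ ≤ (1 / K : ℝ) ^ D * (S.card * (η * ‖c l‖) ^ 2) := by gcongr
        _ = S.card * ((1 / K : ℝ) ^ D * (η * ‖c l‖) ^ 2) := by ring
  have hsum := Finset.sum_le_sum fun l (_ : l ∈ Finset.univ) => hfiber l
  rw [hzero, Finset.sum_sub_distrib, ← Finset.mul_sum, ← Finset.mul_sum] at hsum
  rw [div_mul_eq_mul_div, le_div_iff₀ (by positivity)]
  simp only [farMass]
  linarith

end Decay

/-- exponential decay of the discrete inverse.
Let `n ≥ 2`.  There are constants `d₀ ∈ (0,1)` and `C₇ ∈ (0,1)` depending only on the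
velocity field (through `F`), `n`, `D` and `T` such that whenever `h = dσ` with
`0 < d ≤ d₀` (i.e. `M ≤ d₀ K`) and `t ∈ [0,T]`: if `Q_j^σ` is a grid cell, `f ∈ L²(Ω)`,
and `f_{j,σ} ∈ V_σ^n(Ω)` satisfies
`Σ_i w_i f_{j,σ}(x_i(t)) v(x_i(t)) = ∫_{Q_j^σ} f v dx` for all `v ∈ V_σ^n(Ω)`, then for
every `k ∈ ℕ`:
`‖f_{j,σ}‖²_{L²(Ω∖D_{j,k})} ≤ C₇^⌊k/n⌋ ‖f_{j,σ}‖²_{L²(Ω)}`. -/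
theorem discrete_inverse_exponential_decay
    (D : ℕ) (hD : 0 < D) (T : ℝ) (hT : 0 < T) (F : FlowData D T)
    (n : ℕ) (hn : 2 ≤ n) :
    ∃ d₀ C₇ : ℝ, d₀ ∈ Set.Ioo (0 : ℝ) 1 ∧ C₇ ∈ Set.Ioo (0 : ℝ) 1 ∧
      ∀ M K : ℕ, 0 < M → 0 < K → (M : ℝ) ≤ d₀ * (K : ℝ) →
      ∀ x0 : (Fin D → Fin K) → (Fin D → ℝ), (∀ k, x0 k ∈ cell D K k) →
      ∀ t ∈ Set.Icc (0 : ℝ) T,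
      ∀ j : Fin D → Fin M,
      ∀ f : (Fin D → ℝ) → ℝ, MemLp f 2 (volume.restrict (unitCube D)) →
      ∀ fjσ : (Fin D → ℝ) → ℝ, IsSpline D M n fjσ →
        (∀ v : (Fin D → ℝ) → ℝ, IsSpline D M n v →
          ∑ k : Fin D → Fin K,
              ((1 : ℝ) / K) ^ D * fjσ (F.X 0 t (x0 k)) * v (F.X 0 t (x0 k)) =
            ∫ x in cell D M j, f x * v x) →
      ∀ k : ℕ,
        ∫ x in unitCube D \ cellNbhd D M j k, (fjσ x) ^ 2 ≤
          C₇ ^ (k / n) * ∫ x in unitCube D, (fjσ x) ^ 2 := by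
  obtain ⟨p, rfl⟩ := Nat.exists_eq_add_of_le' hn
  obtain ⟨d₀, θ, hd₀, hθ, hstep⟩ := F.exists_farMass_le p
  refine ⟨d₀, θ, hd₀, hθ, fun M K hM hK hMK x0 hx0 t ht j f _ u hu huv k => ?_⟩
  classical
  have hstep' := hstep M K hM hK hMK x0 hx0 t ht j f u hu huv
  obtain ⟨c, hc⟩ := hu.exists_coeff hM
  have hint : ∀ l, IntegrableOn (fun x => u x ^ 2) (cell D M l) := fun l =>
    (integrableOn_cell (((continuous_tensorEval (c l)).comp (continuous_localCoord l)).pow 2)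
      l).congr_fun (fun x hx => by simp [hc l x hx]) (measurableSet_cell l)
  have htotal : ∫ x in unitCube D, u x ^ 2 = ∑ l, ∫ x in cell D M l, u x ^ 2 := by
    simpa using setIntegral_unitCube_diff hM (fun _ => False) hint
  have hle : ∀ k, farMass u j k ≤ ∫ x in unitCube D, u x ^ 2 := by
    intro k
    rw [htotal, farMass]
    refine Finset.sum_le_sum fun l _ => ?_
    split_ifs
    · exact integral_nonneg fun x => sq_nonneg _
    · exact le_rfl
  have hpow : ∀ a b, farMass u j (b + a * (p + 2)) ≤ θ ^ a * ∫ x in unitCube D, u x ^ 2 := by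
    intro a b
    induction a with
    | zero => simpa using hle b
    | succ a ih =>
      rw [Nat.succ_mul, ← add_assoc, pow_succ', mul_assoc]
      exact (hstep' _).trans (mul_le_mul_of_nonneg_left ih hθ.1.le)
  rw [cellNbhd_eq_iUnion hM, setIntegral_unitCube_diff hM _ hint]
  have h := hpow (k / (p + 2)) (k % (p + 2))
  rwa [Nat.mod_add_div', farMass] at h

end
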